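/- arXiv:math/0503007 — 5 statements merged into one kernel-verified Lean document; each statement's English description precedes it below -/
import Mathlib

section
/- If α₁, α₂, ..., α_r are roots in a crystallographic root system Φ and their sum α₁ + α₂ + ... + α_r is also a root α, then either α₁ = α, or there exists an index i with 2 ≤ i ≤ r such that α₁ + α_i is a root or zero. -/
open scoped RealInnerProductSpace

/-- A (reduced) crystallographic root system in a real inner product space. -/
def IsCrystRootSystem {V : Type*} [NormedAddCommGroup V] [InnerProductSpace ℝ V]
    (Φ : Set V) : Prop :=
  Φ.Finite ∧ (∀ α ∈ Φ, α ≠ 0) ∧ (∀ α ∈ Φ, -α ∈ Φ) ∧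
  (∀ α ∈ Φ, ∀ c : ℝ, c • α ∈ Φ → c = 1 ∨ c = -1) ∧
  (∀ α ∈ Φ, ∀ β ∈ Φ, β - (2 * ⟪α, β⟫ / ⟪α, α⟫) • α ∈ Φ) ∧
  (∀ α ∈ Φ, ∀ β ∈ Φ, ∃ n : ℤ, 2 * ⟪α, β⟫ / ⟪α, α⟫ = (n : ℝ))

theorem rs_inner_pos {V : Type*} [NormedAddCommGroup V] [InnerProductSpace ℝ V]
    {x : V} (hx : x ≠ 0) : 0 < ⟪x, x⟫ := by
  rw [real_inner_self_eq_norm_sq]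
  have := norm_pos_iff.mpr hx
  positivity

theorem rs_add {V : Type*} [NormedAddCommGroup V] [InnerProductSpace ℝ V]
    {Φ : Set V} (hΦ : IsCrystRootSystem Φ) {a b : V} (ha : a ∈ Φ) (hb : b ∈ Φ)
    (h : ⟪a, b⟫ < 0) : a + b ∈ Φ ∨ a + b = 0 := by
  obtain ⟨-, h0, -, -, hrefl, hint⟩ := hΦ
  have haa := rs_inner_pos (h0 a ha)
  have hbb := rs_inner_pos (h0 b hb)
  obtain ⟨n, hn⟩ := hint a ha b hb
  obtain ⟨m, hm⟩ := hint b hb a ha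
  have r1 := hrefl a ha b hb
  have r2 := hrefl b hb a ha
  rw [hn] at r1
  rw [hm] at r2
  rw [real_inner_comm] at hm
  rw [div_eq_iff haa.ne'] at hn
  rw [div_eq_iff hbb.ne'] at hm
  have hn0 : (n : ℝ) < 0 := by by_contra hh; nlinarith
  have hm0 : (m : ℝ) < 0 := by by_contra hh; nlinarith
  have hn0' : n < 0 := by exact_mod_cast hn0
  have hm0' : m < 0 := by exact_mod_cast hm0
  by_cases hn1 : n = -1
  · left; subst hn1; convert r1 using 1; push_cast; rw [neg_one_smul]; abel
  by_cases hm1 : m = -1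
  · left; subst hm1; convert r2 using 1; push_cast; rw [neg_one_smul]; abel
  right
  have hn2 : (n : ℝ) ≤ -2 := by exact_mod_cast (by omega : n ≤ -2)
  have hm2 : (m : ℝ) ≤ -2 := by exact_mod_cast (by omega : m ≤ -2)
  have e : ⟪a + b, a + b⟫ = ⟪a, a⟫ + 2 * ⟪a, b⟫ + ⟪b, b⟫ := real_inner_add_add_self a b
  have e1 : ⟪a, b⟫ ≤ -⟪a, a⟫ := by nlinarith
  have e2 : ⟪a, b⟫ ≤ -⟪b, b⟫ := by nlinarith
  have e3 : ⟪a + b, a + b⟫ ≤ 0 := by linarith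
  by_contra hne
  exact absurd (rs_inner_pos hne) (not_lt.mpr e3)

theorem rs_sub {V : Type*} [NormedAddCommGroup V] [InnerProductSpace ℝ V]
    {Φ : Set V} (hΦ : IsCrystRootSystem Φ) {a b : V} (ha : a ∈ Φ) (hb : b ∈ Φ)
    (h : 0 < ⟪a, b⟫) : a - b ∈ Φ ∨ a - b = 0 := by
  rw [sub_eq_add_neg]
  exact rs_add hΦ ha (hΦ.2.2.1 b hb) (by rw [inner_neg_right]; linarith)

/-- If `x` cannot be added to `g` or `d`, it cannot be added to `g + d`. -/
theorem rs_three {V : Type*} [NormedAddCommGroup V] [InnerProductSpace ℝ V]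
    {Φ : Set V} (hΦ : IsCrystRootSystem Φ) {x g d : V} (hx : x ∈ Φ) (hg : g ∈ Φ) (hd : d ∈ Φ)
    (hgd : g + d ∈ Φ) (h1 : ¬ (x + g ∈ Φ ∨ x + g = 0)) (h2 : ¬ (x + d ∈ Φ ∨ x + d = 0)) :
    x + (g + d) ∉ Φ := by
  intro hs
  have p1 : 0 ≤ ⟪x, g⟫ := by
    by_contra hh; exact h1 (rs_add hΦ hx hg (not_le.mp hh))
  have p2 : 0 ≤ ⟪x, d⟫ := by
    by_contra hh; exact h2 (rs_add hΦ hx hd (not_le.mp hh))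
  have q1 : ⟪x + (g + d), g⟫ ≤ 0 := by
    by_contra hh
    have := rs_sub hΦ hs hg (not_le.mp hh)
    rw [show x + (g + d) - g = x + d by abel] at this
    exact h2 this
  have q2 : ⟪x + (g + d), d⟫ ≤ 0 := by
    by_contra hh
    have := rs_sub hΦ hs hd (not_le.mp hh)
    rw [show x + (g + d) - d = x + g by abel] at this
    exact h1 this
  have q : ⟪x + (g + d), g + d⟫ ≤ 0 := by rw [inner_add_right]; linarith
  rw [inner_add_left, inner_add_right x] at q
  have := rs_inner_pos (hΦ.2.1 _ hgd)
  linarith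

theorem rs_main {V : Type*} [NormedAddCommGroup V] [InnerProductSpace ℝ V]
    {Φ : Set V} (hΦ : IsCrystRootSystem Φ) {x : V} (hx : x ∈ Φ) {ι : Type*} [DecidableEq ι]
    (a : ι → V) (S : Finset ι) (ha : ∀ i ∈ S, a i ∈ Φ)
    (hno : ∀ i ∈ S, ¬ (x + a i ∈ Φ ∨ x + a i = 0)) (hβ : ∑ i ∈ S, a i ∈ Φ) :
    ¬ (x + ∑ i ∈ S, a i ∈ Φ ∨ x + ∑ i ∈ S, a i = 0) := by
  induction S using Finset.strongInduction with
  | H S ih =>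
  have hpos := rs_inner_pos (hΦ.2.1 _ hβ)
  have hnn : 0 ≤ ⟪x, ∑ i ∈ S, a i⟫ := by
    rw [inner_sum]
    refine Finset.sum_nonneg fun i hi => ?_
    by_contra hlt
    exact hno i hi (rs_add hΦ hx (ha i hi) (not_le.mp hlt))
  have hz : x + ∑ i ∈ S, a i ≠ 0 := by
    intro h
    rw [eq_neg_of_add_eq_zero_left h, inner_neg_left] at hnn
    linarith
  obtain ⟨i, hi, hip⟩ : ∃ i ∈ S, 0 < ⟪∑ j ∈ S, a j, a i⟫ := by
    by_contra hh
    push Not at hh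
    have := Finset.sum_nonpos hh
    rw [← inner_sum] at this
    linarith
  have hsplit := Finset.add_sum_erase S a hi
  have hd : ∑ j ∈ S.erase i, a j = ∑ j ∈ S, a j - a i := by rw [← hsplit]; abel
  rintro (h | h)
  · rcases rs_sub hΦ hβ (ha i hi) hip with h' | h'
    · rw [← hd] at h'
      have := ih _ (Finset.erase_ssubset hi) (fun j hj => ha j (Finset.mem_of_mem_erase hj))
        (fun j hj => hno j (Finset.mem_of_mem_erase hj)) h'
      refine rs_three hΦ hx (ha i hi) h' ?_ (hno i hi) this ?_ <;> rw [hsplit] <;> assumption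
    · rw [sub_eq_zero.mp h'] at h
      exact hno i hi (Or.inl h)
  · exact hz h

/-- If roots `a 0, …, a (r-1)` of a crystallographic root system `Φ` sum to a root `α`,
then either `a 0 = α` or some later `a i` satisfies `a 0 + a i ∈ Φ ∪ {0}`. -/
theorem statement0 {V : Type*} [NormedAddCommGroup V] [InnerProductSpace ℝ V]
    (Φ : Set V) (hΦ : IsCrystRootSystem Φ) (r : ℕ) (hr : 0 < r)
    (a : Fin r → V) (ha : ∀ i, a i ∈ Φ) (α : V) (hα : α ∈ Φ)
    (hsum : ∑ i, a i = α) :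
    a ⟨0, hr⟩ = α ∨
      ∃ i : Fin r, 1 ≤ (i : ℕ) ∧ (a ⟨0, hr⟩ + a i ∈ Φ ∨ a ⟨0, hr⟩ + a i = 0) := by
  classical
  by_contra hcon
  push Not at hcon
  obtain ⟨hne, hno⟩ := hcon
  have hno' : ∀ i ∈ Finset.univ.erase (⟨0, hr⟩ : Fin r),
      ¬ (a ⟨0, hr⟩ + a i ∈ Φ ∨ a ⟨0, hr⟩ + a i = 0) := by
    intro i hi h
    have hi' : i ≠ ⟨0, hr⟩ := Finset.ne_of_mem_erase hi
    have h1 : 1 ≤ (i : ℕ) := by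
      by_contra h0
      exact hi' (Fin.ext (by simp; omega))
    have := hno i h1
    tauto
  have hs : a ⟨0, hr⟩ + ∑ i ∈ Finset.univ.erase (⟨0, hr⟩ : Fin r), a i = α := by
    rw [← hsum]
    exact Finset.add_sum_erase _ _ (Finset.mem_univ _)
  have hnn : 0 ≤ ⟪a ⟨0, hr⟩, ∑ i ∈ Finset.univ.erase (⟨0, hr⟩ : Fin r), a i⟫ := by
    rw [inner_sum]
    refine Finset.sum_nonneg fun i hi => ?_
    by_contra hlt
    exact hno' i hi (rs_add hΦ (ha _) (ha i) (not_le.mp hlt))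
  have hpos : 0 < ⟪a ⟨0, hr⟩, α⟫ := by
    rw [← hs, inner_add_right]
    have := rs_inner_pos (hΦ.2.1 _ (ha ⟨0, hr⟩))
    linarith
  have hβ : ∑ i ∈ Finset.univ.erase (⟨0, hr⟩ : Fin r), a i = α - a ⟨0, hr⟩ := by
    rw [← hs]; abel
  rcases rs_sub hΦ hα (ha ⟨0, hr⟩) (by rwa [real_inner_comm]) with h | h
  · refine rs_main hΦ (ha ⟨0, hr⟩) a _ (fun i _ => ha i) hno' (hβ ▸ h) (Or.inl ?_)
    rw [hs]; exact hα
  · exact hne (sub_eq_zero.mp h).symm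
end

section
/- For w in a finite real reflection group W and a positive root α ∈ Φ⁺, the reflection t_α satisfies t_α ⪯ w in the absolute order if and only if the fixed space F(w) is contained in the hyperplane H_α orthogonal to α. -/
open scoped RealInnerProductSpace
open Module

noncomputable section

variable {V : Type*} [NormedAddCommGroup V] [InnerProductSpace ℝ V]

/-- `g` acts as the orthogonal reflection in the hyperplane orthogonal to `α`. -/
def reflFormula (α : V) (g : V ≃ₗᵢ[ℝ] V) : Prop :=
  ∀ v, g v = v - (2 * ⟪α, v⟫ / ⟪α, α⟫) • α

/-- `g` is an orthogonal reflection. -/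
def IsReflection (g : V ≃ₗᵢ[ℝ] V) : Prop :=
  ∃ α : V, α ≠ 0 ∧ reflFormula α g

/-- A finite real reflection group: a finite subgroup of the orthogonal group
generated by its reflections. -/
def IsReflectionGroup (W : Subgroup (V ≃ₗᵢ[ℝ] V)) : Prop :=
  Finite W ∧ Subgroup.closure {g | g ∈ W ∧ IsReflection g} = W

/-- Reflection length: the least `k` such that `w` is a product of `k` reflections. -/
def refLen (W : Subgroup (V ≃ₗᵢ[ℝ] V)) (w : W) : ℕ :=
  sInf {k | ∃ l : List W, l.length = k ∧ (∀ t ∈ l, IsReflection (t : W).1) ∧ l.prod = w}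

/-- The absolute order on `W`. -/
def absLe (W : Subgroup (V ≃ₗᵢ[ℝ] V)) (u v : W) : Prop :=
  refLen W u + refLen W (u⁻¹ * v) = refLen W v

/-- Covering relation of the absolute order. -/
def covers (W : Subgroup (V ≃ₗᵢ[ℝ] V)) (u v : W) : Prop :=
  absLe W u v ∧ u ≠ v ∧ ∀ z, absLe W u z → absLe W z v → z = u ∨ z = v

/-- The fixed subspace of an isometry. -/
def fixedSpace (g : V ≃ₗᵢ[ℝ] V) : Submodule ℝ V where
  carrier := {v | g v = v}
  add_mem' := by
    intro a b ha hb
    simp only [Set.mem_setOf_eq, map_add] at *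
    rw [ha, hb]
  zero_mem' := by simp
  smul_mem' := by
    intro c a ha
    simp only [Set.mem_setOf_eq, map_smul] at *
    rw [ha]

/-- A root system for the reflection group `W`. -/
def IsRootSystemFor (W : Subgroup (V ≃ₗᵢ[ℝ] V)) (Φ : Set V) : Prop :=
  Φ.Finite ∧ (∀ α ∈ Φ, α ≠ 0) ∧ (∀ α ∈ Φ, -α ∈ Φ) ∧
  (∀ α ∈ Φ, ∀ c : ℝ, c • α ∈ Φ → c = 1 ∨ c = -1) ∧
  (∀ α ∈ Φ, ∃ t ∈ W, reflFormula α t) ∧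
  (∀ t ∈ W, IsReflection t → ∃ α ∈ Φ, reflFormula α t) ∧
  (∀ g ∈ W, ∀ α ∈ Φ, g α ∈ Φ)

/-- A simple system for `Φ`: roots `σ 1, …, σ ℓ` which are linearly independent and
such that every root is a nonnegative or nonpositive combination of them. -/
def IsSimpleSystem (Φ : Set V) {ℓ : ℕ} (σ : Fin ℓ → V) : Prop :=
  (∀ i, σ i ∈ Φ) ∧ LinearIndependent ℝ σ ∧
  ∀ α ∈ Φ, (∃ c : Fin ℓ → ℝ, (∀ i, 0 ≤ c i) ∧ α = ∑ i, c i • σ i) ∨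
           (∃ c : Fin ℓ → ℝ, (∀ i, 0 ≤ c i) ∧ -α = ∑ i, c i • σ i)

/-- `γ` is a Coxeter element of `W`: a product, in some order, of the reflections in
the `ℓ` simple roots of some simple system of the root system `Φ`. -/
def IsCoxeterElement (W : Subgroup (V ≃ₗᵢ[ℝ] V)) (Φ : Set V) (ℓ : ℕ) (γ : W) : Prop :=
  ∃ σ : Fin ℓ → V, IsSimpleSystem Φ σ ∧
    ∃ t : Fin ℓ → W, (∀ i, reflFormula (σ i) (t i).1) ∧
      ∃ l : List (Fin ℓ), l.Nodup ∧ (∀ i, i ∈ l) ∧ (l.map t).prod = γ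

/-- `l` is a maximal (saturated) chain from `u` to `v` in the absolute order. -/
def IsMaximalChain (W : Subgroup (V ≃ₗᵢ[ℝ] V)) (u v : W) (l : List W) : Prop :=
  l.head? = some u ∧ l.getLast? = some v ∧ l.Chain' (covers W)

/-- The label of a chain under the natural edge labeling `λ (x, y) = x⁻¹ * y`. -/
def chainLabels (W : Subgroup (V ≃ₗᵢ[ℝ] V)) (l : List W) : List W :=
  l.zipWith (fun x y => x⁻¹ * y) l.tail

end

section Helpers

variable {V : Type*} [NormedAddCommGroup V] [InnerProductSpace ℝ V]

/-- The orthogonal reflection with root `α`, as a linear isometry. -/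
noncomputable def rf (α : V) : V ≃ₗᵢ[ℝ] V := (ℝ ∙ α)ᗮ.reflection

theorem rf_formula (α : V) : reflFormula α (rf α) := by
  intro v
  rw [rf, Submodule.reflection_orthogonal_apply, Submodule.reflection_singleton_apply,
    real_inner_self_eq_norm_sq]
  simp only [RCLike.ofReal_real_eq_id, id_eq, neg_sub]
  rw [mul_div_assoc, mul_smul, two_smul, two_smul]

theorem eq_rf {α : V} {g : V ≃ₗᵢ[ℝ] V} (h : reflFormula α g) : g = rf α := by
  ext v
  rw [h v, rf_formula α v]

theorem rf_self (α : V) : rf α α = -α :=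
  Submodule.reflection_orthogonalComplement_singleton_eq_neg α

theorem rf_rf (α v : V) : rf α (rf α v) = v := Submodule.reflection_reflection _ v

theorem rf_mul_rf (α : V) : rf α * rf α = 1 := by
  ext v
  exact rf_rf α v

theorem rf_inv (α : V) : (rf α)⁻¹ = rf α := inv_eq_of_mul_eq_one_left (rf_mul_rf α)

theorem rf_of_inner_eq_zero {α v : V} (h : ⟪α, v⟫ = 0) : rf α v = v := by
  rw [rf_formula α v, h]; simp

theorem rf_conj (g : V ≃ₗᵢ[ℝ] V) (α : V) : rf (g α) * g = g * rf α := by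
  ext v
  change rf (g α) (g v) = g (rf α v)
  rw [rf_formula, rf_formula]
  simp

theorem rf_neg (α : V) : rf (-α) = rf α := by
  ext v
  rw [rf_formula, rf_formula]
  simp [neg_div, sub_eq_add_neg]

/-- The positive roots with respect to the functional `⟪·, p⟫`. -/
def posR (Φ : Set V) (p : V) : Set V := {α ∈ Φ | 0 < ⟪α, p⟫}

/-- Simple roots: those positive roots whose reflection permutes the other positive roots. -/
def simR (Φ : Set V) (p : V) : Set V :=
  {α ∈ posR Φ p | ∀ γ ∈ posR Φ p, γ ≠ α → rf α γ ∈ posR Φ p}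

theorem exists_simple [FiniteDimensional ℝ V] {Φ : Set V} (hfin : Φ.Finite)
    (hneg : ∀ α ∈ Φ, -α ∈ Φ)
    (hred : ∀ α ∈ Φ, ∀ c : ℝ, c • α ∈ Φ → c = 1 ∨ c = -1)
    (hst : ∀ α ∈ Φ, ∀ β ∈ Φ, rf α β ∈ Φ) (p : V) (hp : ∀ α ∈ Φ, ⟪α, p⟫ ≠ 0)
    (z β : V) (hβ : β ∈ posR Φ p) (hz : 0 < ⟪β, z⟫) :
    ∃ α ∈ simR Φ p, 0 < ⟪α, z⟫ := by
  have hPfin : (posR Φ p).Finite := hfin.subset (fun x hx => hx.1)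
  -- a generic tie breaking functional
  obtain ⟨f, hf⟩ : ∃ f : Dual ℝ V, ∀ x ∈ posR Φ p, ∀ y ∈ posR Φ p, x ≠ y →
      f x * ⟪y, p⟫ ≠ f y * ⟪x, p⟫ := by
    have : Finite (posR Φ p) := hPfin
    obtain ⟨f, hf⟩ := Module.exists_dual_forall_apply_ne_zero (K := ℝ) (M := V)
      (ι := {q : posR Φ p × posR Φ p // q.1 ≠ q.2})
      (fun q => ⟪(q.1.2 : V), p⟫ • (q.1.1 : V) - ⟪(q.1.1 : V), p⟫ • (q.1.2 : V)) (by
        rintro ⟨⟨⟨x, hx⟩, ⟨y, hy⟩⟩, hne⟩ h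
        apply hne
        simp only at h
        have hx0 := hx.2
        have hy0 := hy.2
        have hxy : y = (⟪y, p⟫ / ⟪x, p⟫) • x := by
          rw [div_eq_inv_mul, mul_smul, sub_eq_zero.mp h, smul_smul,
            inv_mul_cancel₀ hx0.ne', one_smul]
        rcases hred x hx.1 _ (hxy ▸ hy.1) with h1 | h1
        · rw [h1, one_smul] at hxy
          exact Subtype.ext hxy.symm
        · have := div_pos hy0 hx0
          linarith)
    refine ⟨f, fun x hx y hy hne h => hf ⟨⟨⟨x, hx⟩, ⟨y, hy⟩⟩, ?_⟩ ?_⟩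
    · intro h'; exact hne (congrArg Subtype.val h')
    · simp only [map_sub, map_smul, smul_eq_mul]
      linarith
  obtain ⟨μ, hμ, hμmax⟩ := Set.exists_max_image (posR Φ p) (fun x => ⟪x, z⟫ / ⟪x, p⟫) hPfin ⟨β, hβ⟩
  let A : Set V := {x ∈ posR Φ p | ⟪x, z⟫ / ⟪x, p⟫ = ⟪μ, z⟫ / ⟪μ, p⟫}
  obtain ⟨α, hα, hαmax⟩ := Set.exists_max_image A (fun x => f x / ⟪x, p⟫)
    (hPfin.subset (fun x hx => hx.1)) ⟨μ, hμ, rfl⟩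
  have hα0 := hα.1.2
  have hαz : 0 < ⟪α, z⟫ := by
    have h1 := hμmax β hβ
    have h2 : 0 < ⟪β, z⟫ / ⟪β, p⟫ := div_pos hz hβ.2
    have h3 : 0 < ⟪α, z⟫ / ⟪α, p⟫ := by rw [hα.2]; exact h2.trans_le h1
    exact (div_pos_iff_of_pos_right hα0).mp h3
  have hmax : ∀ x ∈ posR Φ p, ⟪x, z⟫ * ⟪α, p⟫ ≤ ⟪α, z⟫ * ⟪x, p⟫ := by
    intro x hx
    have := hμmax x hx
    simp only [← hα.2] at this
    exact (div_le_div_iff₀ hx.2 hα0).mp this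
  have hmax2 : ∀ x ∈ posR Φ p, ⟪x, z⟫ * ⟪α, p⟫ = ⟪α, z⟫ * ⟪x, p⟫ →
      f x * ⟪α, p⟫ ≤ f α * ⟪x, p⟫ := by
    intro x hx h
    have hxA : x ∈ A := ⟨hx, by rw [← hα.2]; exact (div_eq_div_iff hx.2.ne' hα0.ne').mpr h⟩
    exact (div_le_div_iff₀ hx.2 hα0).mp (hαmax x hxA)
  refine ⟨α, ⟨hα.1, fun γ hγ hne => ?_⟩, hαz⟩
  by_contra hcon
  have hΦ' : rf α γ ∈ Φ := hst α hα.1.1 γ hγ.1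
  have hle : ⟪rf α γ, p⟫ < 0 := by
    refine lt_of_le_of_ne ?_ (hp _ hΦ')
    by_contra h
    exact hcon ⟨hΦ', not_le.mp h⟩
  have hδ : -rf α γ ∈ posR Φ p := ⟨hneg _ hΦ', by rw [inner_neg_left]; linarith⟩
  obtain ⟨c, hc⟩ : ∃ c : ℝ, rf α γ = γ - c • α := ⟨_, rf_formula α γ⟩
  have e1 : ⟪rf α γ, z⟫ = ⟪γ, z⟫ - c * ⟪α, z⟫ := by
    rw [hc, inner_sub_left, real_inner_smul_left]
  have e2 : ⟪rf α γ, p⟫ = ⟪γ, p⟫ - c * ⟪α, p⟫ := by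
    rw [hc, inner_sub_left, real_inner_smul_left]
  have e3 : f (rf α γ) = f γ - c * f α := by
    rw [hc, map_sub, map_smul, smul_eq_mul]
  have m1 := hmax γ hγ
  have m2 := hmax _ hδ
  rw [inner_neg_left, inner_neg_left, e1, e2] at m2
  have q1 : ⟪γ, z⟫ * ⟪α, p⟫ = ⟪α, z⟫ * ⟪γ, p⟫ := by nlinarith
  have n1 := hmax2 γ hγ q1
  have n2 := hmax2 _ hδ (by
    rw [inner_neg_left, inner_neg_left, e1, e2]; linear_combination -q1)
  rw [inner_neg_left, map_neg, e3, e2] at n2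
  exact hf γ hγ α hα.1 hne (by nlinarith)

/-- every positive reflection is a product of simple ones -/
theorem rf_eq_prod [FiniteDimensional ℝ V] {Φ : Set V} (hfin : Φ.Finite)
    (h0 : ∀ α ∈ Φ, α ≠ 0) (hneg : ∀ α ∈ Φ, -α ∈ Φ)
    (hred : ∀ α ∈ Φ, ∀ c : ℝ, c • α ∈ Φ → c = 1 ∨ c = -1)
    (hst : ∀ α ∈ Φ, ∀ β ∈ Φ, rf α β ∈ Φ) (p : V) (hp : ∀ α ∈ Φ, ⟪α, p⟫ ≠ 0) :
    ∀ β ∈ posR Φ p, ∃ l : List V, (∀ x ∈ l, x ∈ simR Φ p) ∧ (l.map rf).prod = rf β := by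
  by_contra! hbad
  obtain ⟨β₀, hβ₀, hb₀⟩ := hbad
  let B : Set V := {β ∈ posR Φ p | ∀ l : List V, (∀ x ∈ l, x ∈ simR Φ p) → (l.map rf).prod ≠ rf β}
  have hBfin : B.Finite := hfin.subset (fun x hx => hx.1.1)
  obtain ⟨β, hβ, hmin⟩ := Set.exists_min_image B (fun x => ⟪x, p⟫) hBfin ⟨β₀, hβ₀, hb₀⟩
  obtain ⟨α, hα, hαβ⟩ := exists_simple hfin hneg hred hst p hp β β hβ.1
    (real_inner_self_pos.mpr (h0 _ hβ.1.1))
  by_cases hne : β = α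
  · exact hβ.2 [α] (by simpa using hα) (by simp [hne])
  have hpos := hα.2 β hβ.1 hne
  have hlt : ⟪rf α β, p⟫ < ⟪β, p⟫ := by
    rw [rf_formula α β, inner_sub_left, real_inner_smul_left]
    have : 0 < 2 * ⟪α, β⟫ / ⟪α, α⟫ * ⟪α, p⟫ :=
      mul_pos (div_pos (by linarith) (real_inner_self_pos.mpr (h0 _ hα.1.1))) hα.1.2
    linarith
  have hnB : rf α β ∉ B := fun h => absurd (hmin _ h) (not_le.mpr hlt)
  have : ∃ l : List V, (∀ x ∈ l, x ∈ simR Φ p) ∧ (l.map rf).prod = rf (rf α β) := by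
    by_contra! h
    exact hnB ⟨hpos, h⟩
  obtain ⟨l, hl, hprod⟩ := this
  refine hβ.2 (α :: l ++ [α]) ?_ ?_
  · intro x hx
    simp only [List.cons_append, List.mem_cons, List.mem_append, List.not_mem_nil, or_false] at hx
    rcases hx with rfl | hx | rfl
    · exact hα
    · exact hl x hx
    · exact hα
  · simp only [List.cons_append, List.map_cons, List.map_append, List.map_nil, List.prod_cons,
      List.prod_append, List.prod_nil, mul_one, hprod]
    rw [rf_conj, ← mul_assoc, rf_mul_rf, one_mul]

theorem exchange {Φ : Set V} {p : V} {α : V} (hα : α ∈ simR Φ p) :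
    ∀ l : List V, (∀ x ∈ l, x ∈ simR Φ p) → (l.map rf).prod α ∉ posR Φ p →
      ∃ l' : List V, (∀ x ∈ l', x ∈ simR Φ p) ∧ l'.length + 1 = l.length ∧
        (l'.map rf).prod = (l.map rf).prod * rf α := by
  intro l
  induction l with
  | nil =>
    intro _ h
    exact absurd hα.1 h
  | cons s l ih =>
    intro hl h
    have hs : s ∈ simR Φ p := hl s (by simp)
    have hl' : ∀ x ∈ l, x ∈ simR Φ p := fun x hx => hl x (by simp [hx])
    by_cases hγ : (l.map rf).prod α ∈ posR Φ p
    · have hse : (l.map rf).prod α = s := by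
        by_contra hne
        exact h (hs.2 _ hγ hne)
      refine ⟨l, hl', rfl, ?_⟩
      have := rf_conj (l.map rf).prod α
      rw [hse] at this
      rw [List.map_cons, List.prod_cons, this, mul_assoc, rf_mul_rf, mul_one]
    · obtain ⟨l', h1, h2, h3⟩ := ih hl' hγ
      refine ⟨s :: l', ?_, by simp [h2], ?_⟩
      · intro x hx
        rcases List.mem_cons.mp hx with rfl | hx
        · exact hs
        · exact h1 x hx
      · simp [h3, mul_assoc]

theorem prod_eq_one {Φ : Set V} {p : V} : ∀ (n : ℕ) (l : List V), l.length = n →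
    (∀ x ∈ l, x ∈ simR Φ p) → (∀ γ ∈ posR Φ p, (l.map rf).prod γ ∈ posR Φ p) →
    (l.map rf).prod = 1 := by
  intro n
  induction n using Nat.strong_induction_on with
  | _ n ih =>
    intro l hn hl hpos
    rcases List.eq_nil_or_concat l with rfl | ⟨l₁, α, rfl⟩
    · simp
    rw [List.concat_eq_append] at *
    have hα : α ∈ simR Φ p := hl α (by simp)
    have e : ((l₁ ++ [α]).map rf).prod = (l₁.map rf).prod * rf α := by simp
    have h1 : (l₁.map rf).prod α ∉ posR Φ p := by
      intro h
      have h2 := (hpos α hα.1).2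
      have h3 := h.2
      rw [e] at h2
      change 0 < ⟪(l₁.map rf).prod (rf α α), p⟫ at h2
      rw [rf_self, map_neg, inner_neg_left] at h2
      linarith
    obtain ⟨l', g1, g2, g3⟩ := exchange hα l₁ (fun x hx => hl x (by simp [hx])) h1
    rw [e, ← g3] at hpos ⊢
    refine ih l'.length ?_ l' rfl g1 hpos
    simp at hn
    omega

/-- Every nontrivial element of the group fixes pointwise a subspace lying in some `H_β`. -/
theorem exists_root [FiniteDimensional ℝ V] (W : Subgroup (V ≃ₗᵢ[ℝ] V)) (hW : IsReflectionGroup W)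
    (Φ : Set V) (hΦ : IsRootSystemFor W Φ) (w : V ≃ₗᵢ[ℝ] V) (hw : w ∈ W) (hw1 : w ≠ 1) :
    ∃ β ∈ Φ, ∀ v ∈ fixedSpace w, ⟪β, v⟫ = 0 := by
  obtain ⟨hfin, h0, hneg, hred, hin, hall, hinv⟩ := hΦ
  by_contra! hcon
  have hst : ∀ α ∈ Φ, ∀ β ∈ Φ, rf α β ∈ Φ := by
    intro α hα β hβ
    obtain ⟨t, ht, htα⟩ := hin α hα
    rw [← eq_rf htα]
    exact hinv t ht β hβ
  obtain ⟨p, hpw, hp⟩ : ∃ p ∈ fixedSpace w, ∀ α ∈ Φ, ⟪α, p⟫ ≠ 0 := by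
    have : Finite Φ := hfin
    obtain ⟨p, hpw, hp⟩ := Module.Dual.exists_forall_mem_ne_zero_of_forall_exists
      (fixedSpace w) (fun α : Φ => (innerₛₗ ℝ (α : V) : V →ₗ[ℝ] ℝ)) (fun α => hcon α α.2)
    exact ⟨p, hpw, fun α hα => hp ⟨α, hα⟩⟩
  have hword : ∀ g ∈ Subgroup.closure {g | g ∈ W ∧ IsReflection g},
      ∃ l : List V, (∀ x ∈ l, x ∈ simR Φ p) ∧ (l.map rf).prod = g := by
    intro g hg
    induction hg using Subgroup.closure_induction with
    | mem x hx =>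
      obtain ⟨α, hα, hxα⟩ := hall x hx.1 hx.2
      rw [eq_rf hxα]
      rcases lt_or_gt_of_ne (hp α hα) with h | h
      · rw [← rf_neg]
        exact rf_eq_prod hfin h0 hneg hred hst p hp _
          ⟨hneg α hα, by rw [inner_neg_left]; linarith⟩
      · exact rf_eq_prod hfin h0 hneg hred hst p hp _ ⟨hα, h⟩
    | one => exact ⟨[], by simp, by simp⟩
    | mul x y _ _ hx hy =>
      obtain ⟨l₁, a₁, rfl⟩ := hx
      obtain ⟨l₂, a₂, rfl⟩ := hy
      refine ⟨l₁ ++ l₂, fun x hx => ?_, by simp⟩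
      rcases List.mem_append.mp hx with h | h
      · exact a₁ x h
      · exact a₂ x h
    | inv x _ hx =>
      obtain ⟨l, a, rfl⟩ := hx
      refine ⟨l.reverse, fun x hx => a x (List.mem_reverse.mp hx), ?_⟩
      rw [List.prod_inv_reverse, List.map_map, List.map_reverse]
      have : l.map ((fun x => x⁻¹) ∘ rf) = l.map rf :=
        List.map_congr_left fun x _ => rf_inv x
      rw [this]
  obtain ⟨l, hl, rfl⟩ := hword w (hW.2.symm ▸ hw)
  refine hw1 (prod_eq_one _ l rfl hl fun γ hγ => ⟨hinv _ hw γ hγ.1, ?_⟩)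
  have : (l.map rf).prod p = p := hpw
  rw [← this, LinearIsometryEquiv.inner_map_map]
  exact hγ.2

theorem finrank_fix_inf [FiniteDimensional ℝ V] (F : Submodule ℝ V) (α : V) :
    finrank ℝ F ≤ finrank ℝ (F ⊓ (ℝ ∙ α)ᗮ : Submodule ℝ V) + 1 := by
  have h1 := Submodule.finrank_sup_add_finrank_inf_eq F (ℝ ∙ α)ᗮ
  have h2 := (ℝ ∙ α).finrank_add_finrank_orthogonal
  have h3 : finrank ℝ (ℝ ∙ α) ≤ 1 := (finrank_span_le_card _).trans (by simp)
  have h4 := Submodule.finrank_le (F ⊔ (ℝ ∙ α)ᗮ)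
  omega

theorem fix_inf_le (g : V ≃ₗᵢ[ℝ] V) (α : V) :
    fixedSpace g ⊓ (ℝ ∙ α)ᗮ ≤ fixedSpace (rf α * g) := by
  rintro v ⟨h1, h2⟩
  have h1 : g v = v := h1
  change rf α (g v) = v
  rw [h1]
  exact rf_of_inner_eq_zero (Submodule.mem_orthogonal_singleton_iff_inner_right.mp h2)

theorem finrank_fix_le [FiniteDimensional ℝ V] (g : V ≃ₗᵢ[ℝ] V) (α : V) :
    finrank ℝ (fixedSpace g) ≤ finrank ℝ (fixedSpace (rf α * g)) + 1 :=
  (finrank_fix_inf _ α).trans (Nat.add_le_add_right (Submodule.finrank_mono (fix_inf_le g α)) 1)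

theorem finrank_fix_lt [FiniteDimensional ℝ V] (g : V ≃ₗᵢ[ℝ] V) (α : V) (hα : α ≠ 0)
    (h : ∀ v ∈ fixedSpace g, ⟪α, v⟫ = 0) :
    finrank ℝ (fixedSpace g) < finrank ℝ (fixedSpace (rf α * g)) := by
  let R : Submodule ℝ V := LinearMap.range ((g.toLinearEquiv : V →ₗ[ℝ] V) - LinearMap.id)
  have hR : α ∈ R := by
    rw [← Submodule.orthogonal_orthogonal R, Submodule.mem_orthogonal]
    intro v hv
    rw [real_inner_comm]
    apply h
    have h1 : ⟪g v - v, v⟫ = 0 := hv _ ⟨v, rfl⟩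
    have h2 : ⟪g v, g v⟫ = ⟪v, v⟫ := g.inner_map_map v v
    have h3 : ⟪g v - v, g v - v⟫ = 0 := by
      rw [inner_sub_left] at h1
      rw [inner_sub_left, inner_sub_right, inner_sub_right, h2, real_inner_comm]
      rw [real_inner_comm v (g v)] at *
      linarith
    exact sub_eq_zero.mp (inner_self_eq_zero.mp h3)
  obtain ⟨x, hx⟩ := hR
  have hx : g x - x = α := hx
  apply Submodule.finrank_lt_finrank_of_lt
  refine lt_of_le_of_ne ?_ ?_
  · intro v hv
    exact fix_inf_le g α ⟨hv, Submodule.mem_orthogonal_singleton_iff_inner_right.mpr (h v hv)⟩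
  · intro he
    have h1 : x ∈ fixedSpace (rf α * g) := by
      change rf α (g x) = x
      rw [← hx]
      exact Submodule.reflection_sub (g.norm_map x)
    rw [← he] at h1
    have h1 : g x = x := h1
    exact hα (by rw [← hx, h1, sub_self])

theorem finrank_fix_one : finrank ℝ (fixedSpace (1 : V ≃ₗᵢ[ℝ] V)) = finrank ℝ V := by
  have : fixedSpace (1 : V ≃ₗᵢ[ℝ] V) = ⊤ := by
    rw [eq_top_iff]; intro v _; rfl
  rw [this, finrank_top]

theorem lower_bound [FiniteDimensional ℝ V] (W : Subgroup (V ≃ₗᵢ[ℝ] V)) (l : List W)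
    (hl : ∀ t ∈ l, IsReflection (t : W).1) :
    finrank ℝ V ≤ finrank ℝ (fixedSpace (l.prod : W).1) + l.length := by
  induction l with
  | nil => exact finrank_fix_one.ge
  | cons s l ih =>
    obtain ⟨α, -, hα⟩ := hl s (by simp)
    have h1 := ih (fun t ht => hl t (by simp [ht]))
    have h2 := finrank_fix_le l.prod.1 α
    rw [← eq_rf hα] at h2
    have h3 : ((s :: l).prod : W).1 = s.1 * l.prod.1 := by simp
    rw [h3, List.length_cons]
    omega

theorem upper_bound [FiniteDimensional ℝ V] (W : Subgroup (V ≃ₗᵢ[ℝ] V)) (hW : IsReflectionGroup W)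
    (Φ : Set V) (hΦ : IsRootSystemFor W Φ) : ∀ (n : ℕ) (w : W),
    finrank ℝ V - finrank ℝ (fixedSpace w.1) = n →
    ∃ l : List W, (∀ t ∈ l, IsReflection (t : W).1) ∧ l.prod = w ∧ l.length ≤ n := by
  intro n
  induction n using Nat.strong_induction_on with
  | _ n ih =>
    intro w hn
    by_cases hw : w = 1
    · exact ⟨[], by simp, by simp [hw], by simp⟩
    obtain ⟨β, hβ, hfix⟩ := exists_root W hW Φ hΦ w.1 w.2 (fun h => hw (Subtype.ext h))
    have hβ0 := hΦ.2.1 β hβ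
    have h1 := finrank_fix_lt w.1 β hβ0 hfix
    have h2 := Submodule.finrank_le (fixedSpace (rf β * w.1))
    obtain ⟨t, ht, htβ⟩ := hΦ.2.2.2.2.1 β hβ
    have hte := eq_rf htβ
    have hval : ((⟨t, ht⟩ : W) * w).1 = rf β * w.1 := by rw [← hte]; rfl
    obtain ⟨l, g1, g2, g3⟩ := ih (finrank ℝ V - finrank ℝ (fixedSpace (rf β * w.1))) (by omega)
      ((⟨t, ht⟩ : W) * w) (by rw [hval])
    refine ⟨(⟨t, ht⟩ : W) :: l, ?_, ?_, ?_⟩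
    · intro x hx
      rcases List.mem_cons.mp hx with rfl | hx
      · exact ⟨β, hβ0, htβ⟩
      · exact g1 x hx
    · rw [List.prod_cons, g2, ← mul_assoc]
      have : (⟨t, ht⟩ : W) * (⟨t, ht⟩ : W) = 1 := by
        apply Subtype.ext
        change t * t = 1
        rw [hte, rf_mul_rf]
      rw [this, one_mul]
    · rw [List.length_cons]
      omega

/-- The lemma of Carter. -/
theorem refLen_add [FiniteDimensional ℝ V] (W : Subgroup (V ≃ₗᵢ[ℝ] V)) (hW : IsReflectionGroup W)
    (Φ : Set V) (hΦ : IsRootSystemFor W Φ) (w : W) :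
    refLen W w + finrank ℝ (fixedSpace w.1) = finrank ℝ V := by
  obtain ⟨l, g1, g2, g3⟩ := upper_bound W hW Φ hΦ _ w rfl
  have h1 : refLen W w ≤ l.length := Nat.sInf_le ⟨l, rfl, g1, g2⟩
  obtain ⟨l', k1, k2, k3⟩ : refLen W w ∈ {k | ∃ l : List W, l.length = k ∧
      (∀ t ∈ l, IsReflection (t : W).1) ∧ l.prod = w} := Nat.sInf_mem ⟨_, l, rfl, g1, g2⟩
  have h2 := lower_bound W l' k2
  rw [k3, k1] at h2
  have h3 := Submodule.finrank_le (fixedSpace w.1)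
  omega

end Helpers

/-- For `w ∈ W` and a positive root `α`, the reflection `t_α` satisfies `t_α ⪯ w`
in absolute order iff the fixed space `F(w)` is contained in the hyperplane `H_α`. -/
theorem statement4 {V : Type*} [NormedAddCommGroup V] [InnerProductSpace ℝ V]
    [FiniteDimensional ℝ V]
    (W : Subgroup (V ≃ₗᵢ[ℝ] V)) (hW : IsReflectionGroup W)
    (Φ Φpos : Set V) (hΦ : IsRootSystemFor W Φ)
    (hpos : ∃ f : V →ₗ[ℝ] ℝ, (∀ α ∈ Φ, f α ≠ 0) ∧ Φpos = {α ∈ Φ | 0 < f α})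
    (α : V) (hα : α ∈ Φpos)
    (t : W) (ht : reflFormula α t.1) (w : W) :
    absLe W t w ↔ ∀ v ∈ fixedSpace w.1, ⟪α, v⟫ = 0 := by
  have hα0 : α ≠ 0 := by
    obtain ⟨f, _, rfl⟩ := hpos
    exact hΦ.2.1 α hα.1
  have hte : t.1 = rf α := eq_rf ht
  have hinv : (t⁻¹ * w).1 = rf α * w.1 := by
    change (t.1)⁻¹ * w.1 = _
    rw [hte, rf_inv]
  have ct := refLen_add W hW Φ hΦ t
  have cw := refLen_add W hW Φ hΦ w
  have cu := refLen_add W hW Φ hΦ (t⁻¹ * w)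
  rw [hinv] at cu
  rw [hte] at ct
  have h1 : finrank ℝ (fixedSpace (rf α)) < finrank ℝ V := by
    apply Submodule.finrank_lt
    intro h
    have h2 : α ∈ fixedSpace (rf α) := h ▸ Submodule.mem_top
    have h2 : rf α α = α := h2
    rw [rf_self] at h2
    exact hα0 (by
      have h3 : (2 : ℝ) • α = 0 := by
        rw [two_smul]
        nth_rewrite 1 [← h2]
        simp
      simpa using h3)
  have h2 := finrank_fix_le (1 : V ≃ₗᵢ[ℝ] V) α
  rw [finrank_fix_one, mul_one] at h2
  unfold absLe
  constructor
  · intro h v hv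
    have hle : fixedSpace (rf α * w.1) ⊓ (ℝ ∙ α)ᗮ ≤ fixedSpace w.1 := by
      have := fix_inf_le (rf α * w.1) α
      rwa [← mul_assoc, rf_mul_rf, one_mul] at this
    have h3 := finrank_fix_inf (fixedSpace (rf α * w.1)) α
    have heq := Submodule.eq_of_le_of_finrank_le hle (by omega)
    rw [← heq] at hv
    exact Submodule.mem_orthogonal_singleton_iff_inner_right.mp hv.2
  · intro h
    have h3 := finrank_fix_lt w.1 α hα0 h
    have h4 := finrank_fix_le (rf α * w.1) α
    rw [← mul_assoc, rf_mul_rf, one_mul] at h4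
    omega
end

section
/- If W is a Weyl group and t_{α₁} t_{α₂} ⋯ t_{α_ℓ} is a shortest factorization of a Coxeter element into reflections (α_i ∈ Φ⁺), then {α₁, α₂, ..., α_ℓ} is a ℤ-basis of the root lattice Q_Φ. -/
open scoped RealInnerProductSpace
open Module

/-- The coroot of a vector. -/
noncomputable def corootVec {V : Type*} [NormedAddCommGroup V] [InnerProductSpace ℝ V] (β : V) : V :=
  (2 / ⟪β, β⟫) • β

/-- A product of reflections differs from the identity by a combination of the roots, whose
coefficients are obtained from the coroot functionals by a unitriangular change. -/
theorem prod_refl_expand {V : Type*} [NormedAddCommGroup V] [InnerProductSpace ℝ V]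
    (n : ℕ) : ∀ (α : Fin n → V) (t : Fin n → (V ≃ₗᵢ[ℝ] V)),
    (∀ i, reflFormula (α i) (t i)) →
    ∃ (F : Fin n → V → ℝ) (U : Matrix (Fin n) (Fin n) ℝ),
      U.BlockTriangular id ∧ (∀ i, U i i = 1) ∧
      (∀ v, v - (List.ofFn t).prod v = ∑ i, F i v • α i) ∧
      ∀ i v, 2 * ⟪α i, v⟫ / ⟪α i, α i⟫ = ∑ j, U i j * F j v := by
  induction n with
  | zero =>
    intro α t _
    exact ⟨fun _ _ => 0, 1, Matrix.blockTriangular_one, fun i => i.elim0, by simp,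
      fun i => i.elim0⟩
  | succ n ih =>
    intro α t ht
    obtain ⟨F, U, hU, hU1, hF, hB⟩ := ih (fun i => α i.succ) (fun i => t i.succ)
      (fun i => ht i.succ)
    let P := (List.ofFn (fun i : Fin n => t i.succ)).prod
    have hF' : ∀ v, P v = v - ∑ i, F i v • α i.succ := by
      intro v
      rw [← hF v]
      simp [P]
    refine ⟨Fin.cons (fun v => 2 * ⟪α 0, P v⟫ / ⟪α 0, α 0⟫) F,
      Fin.cons (Fin.cons 1 (fun j => 2 * ⟪α 0, α j.succ⟫ / ⟪α 0, α 0⟫))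
        (fun i => Fin.cons 0 (U i)), ?_, ?_, ?_, ?_⟩
    · intro i j hij
      rcases Fin.eq_zero_or_eq_succ j with rfl | ⟨j, rfl⟩
      · rcases Fin.eq_zero_or_eq_succ i with rfl | ⟨i, rfl⟩
        · exact absurd hij (lt_irrefl _)
        · simp
      · rcases Fin.eq_zero_or_eq_succ i with rfl | ⟨i, rfl⟩
        · exact absurd hij (by simp)
        · have : id j < id i := by simpa using hij
          simpa using hU this
    · intro i
      refine Fin.cases ?_ (fun i => ?_) i
      · simp
      · simpa using hU1 i
    · intro v
      rw [List.ofFn_succ, List.prod_cons, Fin.sum_univ_succ]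
      simp only [Fin.cons_zero, Fin.cons_succ]
      have h0 : (t 0 * P) v = t 0 (P v) := rfl
      change v - (t 0 * P) v = _
      rw [h0, ht 0 (P v), ← hF v]
      change _ = _ + (v - P v)
      abel
    · intro i v
      rw [Fin.sum_univ_succ]
      refine Fin.cases ?_ (fun i => ?_) i
      · simp only [Fin.cons_zero, Fin.cons_succ, hF' v, inner_sub_right, inner_sum,
          inner_smul_right]
        rw [one_mul, mul_sub, sub_div, Finset.mul_sum, Finset.sum_div]
        rw [eq_comm, sub_add_eq_add_sub, sub_eq_iff_eq_add]
        congr 1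
        apply Finset.sum_congr rfl
        intro j _
        ring
      · simp only [Fin.cons_zero, Fin.cons_succ, zero_mul, zero_add]
        exact hB i v

/-- The determinant of `1 - w` for a product `w` of reflections. -/
theorem det_one_sub_prod {V : Type*} [NormedAddCommGroup V] [InnerProductSpace ℝ V]
    {n : ℕ} (b : Basis (Fin n) ℝ V) (α : Fin n → V) (t : Fin n → (V ≃ₗᵢ[ℝ] V))
    (ht : ∀ i, reflFormula (α i) (t i)) :
    (Matrix.of fun k l => b.repr (b l - (List.ofFn t).prod (b l)) k).det =
      (Matrix.of fun k j => b.repr (α j) k).det *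
      (Matrix.of fun i l => ⟪corootVec (α i), b l⟫).det := by
  obtain ⟨F, U, hU, hU1, hF, hB⟩ := prod_refl_expand n α t ht
  have h1 : (Matrix.of fun k l => b.repr (b l - (List.ofFn t).prod (b l)) k) =
      (Matrix.of fun k j => b.repr (α j) k) * (Matrix.of fun i l => F i (b l)) := by
    ext k l
    rw [Matrix.mul_apply, Matrix.of_apply, hF]
    simp [Finsupp.finset_sum_apply, mul_comm]
  have h2 : (Matrix.of fun i l => ⟪corootVec (α i), b l⟫) =
      U * (Matrix.of fun i l => F i (b l)) := by
    ext i l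
    rw [Matrix.mul_apply, Matrix.of_apply]
    simp only [Matrix.of_apply]
    rw [← hB, corootVec, real_inner_smul_left]
    ring
  rw [h1, h2, Matrix.det_mul, Matrix.det_mul, Matrix.det_of_upperTriangular hU]
  simp [hU1]

/-- Every root is an integral combination of simple roots, and likewise for coroots. -/
theorem root_integral {V : Type*} [NormedAddCommGroup V] [InnerProductSpace ℝ V]
    (W : Subgroup (V ≃ₗᵢ[ℝ] V)) (Φ : Set V) (hΦ : IsRootSystemFor W Φ)
    (hcryst : ∀ α ∈ Φ, ∀ β ∈ Φ, ∃ n : ℤ, 2 * ⟪α, β⟫ / ⟪α, α⟫ = (n : ℝ))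
    {n : ℕ} (b : Basis (Fin n) ℝ V) (hb : IsSimpleSystem Φ b) (β : V) (hβ : β ∈ Φ) :
    β ∈ Submodule.span ℤ (Set.range b) ∧
      corootVec β ∈ Submodule.span ℤ (Set.range fun i => corootVec (b i)) := by
  obtain ⟨hfin, hne, hneg, hred, hrefl, -, hstab⟩ := hΦ
  obtain ⟨hbΦ, -, hsgn⟩ := hb
  have hrepr : ∀ x : V, ∀ c : Fin n → ℝ, x = ∑ i, c i • b i → ∀ i, b.repr x i = c i := by
    intro x c hx i
    rw [hx, b.repr_sum_self]
  have hsgn' : ∀ x ∈ Φ, (∀ i, 0 ≤ b.repr x i) ∨ (∀ i, b.repr x i ≤ 0) := by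
    intro x hx
    rcases hsgn x hx with ⟨c, hc, h⟩ | ⟨c, hc, h⟩
    · left; intro i; rw [hrepr x c h i]; exact hc i
    · right; intro i
      have := hrepr _ c h i
      simp only [map_neg, Finsupp.neg_apply] at this
      linarith [hc i]
  let Good : V → Prop := fun β => β ∈ Submodule.span ℤ (Set.range b) ∧
      corootVec β ∈ Submodule.span ℤ (Set.range fun i => corootVec (b i))
  have key : ∀ x ∈ Φ, (∀ i, 0 ≤ b.repr x i) → Good x := by
    by_contra hcon
    push Not at hcon
    let S : Set V := {x ∈ Φ | (∀ i, 0 ≤ b.repr x i) ∧ ¬ Good x}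
    have hSfin : S.Finite := hfin.subset (fun x hx => hx.1)
    have hSne : S.Nonempty := by
      obtain ⟨x, h1, h2, h3⟩ := hcon
      exact ⟨x, h1, h2, h3⟩
    obtain ⟨x, ⟨hxΦ, hx0, hxbad⟩, hmin⟩ :=
      Set.exists_min_image S (fun x => ∑ i, b.repr x i) hSfin hSne
    apply hxbad
    have hxx : 0 < ⟪x, x⟫ := real_inner_self_pos.2 (hne x hxΦ)
    have hxx' : ⟪x, x⟫ = ∑ i, b.repr x i * ⟪b i, x⟫ := by
      conv_lhs => rw [← b.sum_repr x]
      rw [sum_inner]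
      simp only [real_inner_smul_left, b.sum_repr]
    obtain ⟨i, -, hi⟩ : ∃ i ∈ Finset.univ, 0 < b.repr x i * ⟪b i, x⟫ := by
      apply Finset.exists_lt_of_sum_lt
      simpa [← hxx'] using hxx
    have hip : 0 < ⟪b i, x⟫ := by
      by_contra h
      push Not at h
      exact absurd hi (not_lt.2 (mul_nonpos_of_nonneg_of_nonpos (hx0 i) h))
    have hii : 0 < ⟪b i, b i⟫ := real_inner_self_pos.2 (hne _ (hbΦ i))
    obtain ⟨s, hsW, hs⟩ := hrefl _ (hbΦ i)
    obtain ⟨p, hp⟩ := hcryst _ (hbΦ i) _ hxΦ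
    obtain ⟨m, hm⟩ := hcryst _ hxΦ _ (hbΦ i)
    have hppos : (0 : ℝ) < p := by rw [← hp]; positivity
    have hsx : s x = x - (p : ℝ) • b i := by rw [hs x, hp]
    have hsxΦ : s x ∈ Φ := hstab s hsW x hxΦ
    have hsxr : ∀ k, b.repr (s x) k = b.repr x k - p * (if i = k then 1 else 0) := by
      intro k
      rw [hsx]
      simp [Finsupp.single_apply]
    rcases hsgn' _ hsxΦ with h | h
    · have hg : Good (s x) := by
        by_contra hbad
        have := hmin (s x) ⟨hsxΦ, h, hbad⟩
        simp only [hsxr, Finset.sum_sub_distrib] at this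
        simp at this
        have h0 : (0 : ℝ) < p := hppos
        norm_cast at h0
        omega
      obtain ⟨g1, g2⟩ := hg
      have e1 : x = s x + p • b i := by
        rw [hsx, ← Int.cast_smul_eq_zsmul ℝ]; abel
      have e2 : corootVec x = corootVec (s x) + m • corootVec (b i) := by
        have : ⟪s x, s x⟫ = ⟪x, x⟫ := s.inner_map_map x x
        rw [corootVec, corootVec, corootVec, this, hsx, ← Int.cast_smul_eq_zsmul ℝ, ← hm, ← hp,
          smul_sub, smul_smul, smul_smul, real_inner_comm x (b i)]
        have : 2 / ⟪x, x⟫ * (2 * ⟪x, b i⟫ / ⟪b i, b i⟫) =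
          2 * ⟪x, b i⟫ / ⟪x, x⟫ * (2 / ⟪b i, b i⟫) := by ring
        first
          | (rw [this]; abel)
          | (rw [real_inner_comm x (b i)]; rw [this]; abel)
      refine ⟨?_, ?_⟩
      · rw [e1]
        exact add_mem g1 (Submodule.smul_mem _ _ (Submodule.subset_span ⟨i, rfl⟩))
      · rw [e2]
        exact add_mem g2 (Submodule.smul_mem _ _ (Submodule.subset_span ⟨i, rfl⟩))
    · have hz : ∀ k, k ≠ i → b.repr x k = 0 := by
        intro k hk
        have := h k
        rw [hsxr, if_neg (Ne.symm hk)] at this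
        linarith [hx0 k]
      have hxe : x = b.repr x i • b i := by
        conv_lhs => rw [← b.sum_repr x]
        rw [Finset.sum_eq_single i]
        · intro k _ hk
          rw [hz k hk, zero_smul]
        · simp
      have hc : b.repr x i = 1 := by
        rcases hred _ (hbΦ i) (b.repr x i) (hxe ▸ hxΦ) with h1 | h1
        · exact h1
        · linarith [hx0 i]
      rw [hc, one_smul] at hxe
      rw [hxe]
      exact ⟨Submodule.subset_span ⟨i, rfl⟩, Submodule.subset_span ⟨i, rfl⟩⟩
  rcases hsgn' β hβ with h | h
  · exact key β hβ h
  · have := key (-β) (hneg β hβ) (by intro i; simpa using h i)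
    refine ⟨by simpa using neg_mem this.1, ?_⟩
    have h2 := neg_mem this.2
    simpa [corootVec] using h2

/-- If `W` is a Weyl group (crystallographic) and `t_{α₁} ⋯ t_{α_ℓ}` is a shortest
factorization of a Coxeter element into reflections (with `α i ∈ Φ⁺`), then
`α₁, …, α_ℓ` is a `ℤ`-basis of the root lattice `Q_Φ`. -/
theorem statement12 {V : Type*} [NormedAddCommGroup V] [InnerProductSpace ℝ V]
    [FiniteDimensional ℝ V]
    (W : Subgroup (V ≃ₗᵢ[ℝ] V)) (hW : IsReflectionGroup W)
    (Φ Φpos : Set V) (hΦ : IsRootSystemFor W Φ)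
    (hcryst : ∀ α ∈ Φ, ∀ β ∈ Φ, ∃ n : ℤ, 2 * ⟪α, β⟫ / ⟪α, α⟫ = (n : ℝ))
    (hpos : ∃ f : V →ₗ[ℝ] ℝ, (∀ α ∈ Φ, f α ≠ 0) ∧ Φpos = {α ∈ Φ | 0 < f α})
    (ℓ : ℕ) (hℓ : Module.finrank ℝ V = ℓ)
    (γ : W) (hγ : IsCoxeterElement W Φ ℓ γ)
    (α : Fin ℓ → V) (hα : ∀ i, α i ∈ Φpos)
    (t : Fin ℓ → W) (ht : ∀ i, reflFormula (α i) (t i).1)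
    (hprod : (List.ofFn t).prod = γ) (hshort : refLen W γ = ℓ) :
    LinearIndependent ℤ α ∧ Submodule.span ℤ (Set.range α) = Submodule.span ℤ Φ := by
  obtain ⟨σ, hσ, s, hs, l, hnd, hall, hl⟩ := hγ
  -- reindex the simple system along the list
  have hlen : l.length = ℓ := by
    have h1 : l.toFinset = Finset.univ := by ext i; simp [hall i]
    rw [← List.toFinset_card_of_nodup hnd, h1]; simp
  let e : Equiv.Perm (Fin ℓ) := Equiv.ofBijective (fun i => l.get (i.cast hlen.symm))
    (Finite.injective_iff_bijective.1
      (fun i j h => by simpa using hnd.injective_get h))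
  have hmap : l.map s = List.ofFn (fun i => s (e i)) := by
    apply List.ext_getElem
    · simp [hlen]
    · intro i h1 h2
      simp [e]
  have hΦα : ∀ i, α i ∈ Φ := by
    obtain ⟨f, -, rfl⟩ := hpos
    exact fun i => (hα i).1
  have hspan : ⊤ ≤ Submodule.span ℝ (Set.range σ) :=
    (hσ.2.1.span_eq_top_of_card_eq_finrank' (by simp [hℓ])).ge
  let b : Basis (Fin ℓ) ℝ V := Basis.mk hσ.2.1 hspan
  have hbσ : ⇑b = σ := Basis.coe_mk hσ.2.1 hspan
  rw [← hbσ] at hσ hs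
  have hint := root_integral W Φ hΦ hcryst b hσ
  have hN : ∀ j, ∃ c : Fin ℓ → ℤ, ∑ k, c k • b k = α j := fun j =>
    (Submodule.mem_span_range_iff_exists_fun ℤ).1 (hint _ (hΦα j)).1
  have hK : ∀ j, ∃ c : Fin ℓ → ℤ, ∑ k, c k • corootVec (b k) = corootVec (α j) := fun j =>
    (Submodule.mem_span_range_iff_exists_fun ℤ).1 (hint _ (hΦα j)).2
  choose N hN using hN
  choose K hK using hK
  let B : Matrix (Fin ℓ) (Fin ℓ) ℝ := Matrix.of fun i l => ⟪corootVec (b i), b l⟫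
  have hB0 : B.det ≠ 0 := by
    intro h0
    obtain ⟨v, hv0, hv⟩ := Matrix.exists_mulVec_eq_zero_iff.2 h0
    apply hv0
    have hx : ∑ l, v l • b l = 0 := by
      apply InnerProductSpace.ext_inner_left_basis b
      intro i
      have h1 := congrFun hv i
      simp only [Matrix.mulVec, dotProduct, B, Matrix.of_apply, Pi.zero_apply] at h1
      have hii : 0 < ⟪b i, b i⟫ := real_inner_self_pos.2 (b.ne_zero i)
      have h2 : 2 / ⟪b i, b i⟫ * ⟪b i, ∑ l, v l • b l⟫ = 0 := by
        rw [← h1, inner_sum, Finset.mul_sum]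
        apply Finset.sum_congr rfl
        intro l _
        rw [corootVec, real_inner_smul_left, real_inner_smul_right]
        ring
      rw [inner_zero_right]
      rcases mul_eq_zero.1 h2 with h3 | h3
      · exact absurd h3 (by positivity)
      · exact h3
    funext i
    have := Fintype.linearIndependent_iff.1 b.linearIndependent v hx i
    simpa using this
  -- the two factorizations give the same determinant
  have hd1 := det_one_sub_prod b α (fun i => (t i).1) ht
  have hd2 := det_one_sub_prod b (fun i => b (e i)) (fun i => (s (e i)).1) (fun i => hs (e i))
  have hp1 : (List.ofFn fun i => (t i).1).prod = γ.1 := by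
    rw [← hprod, Subgroup.val_list_prod, List.map_ofFn]
    rfl
  have hp2 : (List.ofFn fun i => (s (e i)).1).prod = γ.1 := by
    rw [← hl, hmap, Subgroup.val_list_prod, List.map_ofFn]
    rfl
  rw [hp1] at hd1
  rw [hp2, hd1] at hd2
  have hA2 : (Matrix.of fun k j => b.repr (b (e j)) k) =
      (1 : Matrix (Fin ℓ) (Fin ℓ) ℝ).submatrix id e := by
    ext k j
    simp [Matrix.one_apply, Finsupp.single_apply, eq_comm]
  have hB2 : (Matrix.of fun i l => ⟪corootVec (b (e i)), b l⟫) = B.submatrix e id := by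
    ext k j
    simp [B]
  have hA1 : (Matrix.of fun k j => b.repr (α j) k) =
      ((Matrix.of N).map (Int.castRingHom ℝ)).transpose := by
    ext k j
    simp only [Matrix.of_apply, Matrix.transpose_apply, Matrix.map_apply]
    rw [← hN j]
    simp only [← Int.cast_smul_eq_zsmul ℝ]
    rw [b.repr_sum_self]
    simp
  have hB1 : (Matrix.of fun i l => ⟪corootVec (α i), b l⟫) =
      (Matrix.of K).map (Int.castRingHom ℝ) * B := by
    ext i l
    simp only [Matrix.mul_apply, Matrix.of_apply, Matrix.map_apply, B]
    rw [← hK i]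
    simp only [← Int.cast_smul_eq_zsmul ℝ]
    rw [sum_inner]
    simp [real_inner_smul_left]
  rw [hA1, hB1, hA2, hB2, Matrix.det_permute', Matrix.det_permute, Matrix.det_transpose,
    Matrix.det_mul, Matrix.det_one, mul_one, ← mul_assoc, ← mul_assoc] at hd2
  have hd3 := mul_right_cancel₀ hB0 hd2
  have hsg : ((Equiv.Perm.sign e : ℤ) : ℝ) * ((Equiv.Perm.sign e : ℤ) : ℝ) = 1 := by
    rw [← Int.cast_mul, ← Units.val_mul, Int.units_mul_self]
    simp
  rw [hsg] at hd3
  have hd4 : (Matrix.of N).det * (Matrix.of K).det = 1 := by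
    have h1 := (Int.castRingHom ℝ).map_det (Matrix.of N)
    have h2 := (Int.castRingHom ℝ).map_det (Matrix.of K)
    simp only [RingHom.mapMatrix_apply] at h1 h2
    rw [← h1, ← h2, ← map_mul] at hd3
    simp only [eq_intCast] at hd3
    exact_mod_cast hd3
  have hunit : IsUnit (Matrix.of N).det := IsUnit.of_mul_eq_one _ hd4
  have hbα : ∀ k, b k = ∑ j, ((Matrix.of N)⁻¹ k j) • α j := by
    intro k
    have hmul := Matrix.nonsing_inv_mul (Matrix.of N) hunit
    calc b k = ∑ m, ((1 : Matrix (Fin ℓ) (Fin ℓ) ℤ) k m) • b m := by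
          simp [Matrix.one_apply]
      _ = ∑ m, ∑ j, ((Matrix.of N)⁻¹ k j * N j m) • b m := by
          apply Finset.sum_congr rfl
          intro m _
          rw [← hmul, Matrix.mul_apply, Finset.sum_smul]
          rfl
      _ = ∑ j, ((Matrix.of N)⁻¹ k j) • α j := by
          rw [Finset.sum_comm]
          apply Finset.sum_congr rfl
          intro j _
          rw [← hN j, Finset.smul_sum]
          simp only [mul_smul]
  have hbmem : ∀ k, b k ∈ Submodule.span ℤ (Set.range α) := by
    intro k
    rw [hbα k]
    exact Submodule.sum_mem _ fun j _ =>
      Submodule.smul_mem _ _ (Submodule.subset_span ⟨j, rfl⟩)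
  constructor
  · have hli : LinearIndependent ℝ α := by
      apply linearIndependent_of_top_le_span_of_card_eq_finrank
      · rw [← b.span_eq, Submodule.span_le]
        rintro _ ⟨k, rfl⟩
        exact Submodule.span_subset_span ℤ ℝ _ (hbmem k)
      · simp [hℓ]
    exact hli.restrict_scalars' ℤ
  · apply le_antisymm
    · apply Submodule.span_mono
      rintro _ ⟨j, rfl⟩
      exact hΦα j
    · rw [Submodule.span_le]
      intro x hx
      refine (Submodule.span_le.2 ?_ : Submodule.span ℤ (Set.range b) ≤ _) (hint x hx).1
      rintro _ ⟨k, rfl⟩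
      exact hbmem k
end

section
/- If w ⪯ γ for some Coxeter element γ of a finite real reflection group W, then w is a parabolic Coxeter element, i.e., w is a Coxeter element of a parabolic subgroup of W; conversely every parabolic Coxeter element satisfies w ⪯ γ for some Coxeter element γ of W. -/
open scoped RealInnerProductSpace
open Module

/-- `w` is a parabolic Coxeter element: for some simple system `σ` with associated
simple reflections `t i`, `w` is the product (in some order, without repetition) of
the simple reflections indexed by a subset, i.e. a Coxeter element of the standard
parabolic subgroup they generate. -/
def IsParabolicCoxeterElement {V : Type*} [NormedAddCommGroup V]
    [InnerProductSpace ℝ V] (W : Subgroup (V ≃ₗᵢ[ℝ] V)) (Φ : Set V) (ℓ : ℕ)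
    (w : W) : Prop :=
  ∃ σ : Fin ℓ → V, IsSimpleSystem Φ σ ∧
    ∃ t : Fin ℓ → W, (∀ i, reflFormula (σ i) (t i).1) ∧
      ∃ l : List (Fin ℓ), l.Nodup ∧ (l.map t).prod = w


section Helpers

variable {V : Type*} [NormedAddCommGroup V] [InnerProductSpace ℝ V]

theorem lie_mul_apply (g h : V ≃ₗᵢ[ℝ] V) (v : V) : (g * h) v = g (h v) := rfl

theorem refl_unique {α : V} {g h : V ≃ₗᵢ[ℝ] V} (hg : reflFormula α g) (hh : reflFormula α h) :
    g = h := by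
  ext v
  rw [hg v, hh v]

theorem refl_conj {α : V} {g : V ≃ₗᵢ[ℝ] V} (hg : reflFormula α g) (h : V ≃ₗᵢ[ℝ] V) :
    reflFormula (h α) (h * g * h⁻¹) := by
  intro v
  have h1 : h (h⁻¹ v) = v := by
    rw [← lie_mul_apply]; simp
  have h2 : ⟪α, h⁻¹ v⟫ = ⟪h α, v⟫ := by
    rw [← h.inner_map_map, h1]
  rw [lie_mul_apply, lie_mul_apply, hg, map_sub, map_smul, h1, h2,
    h.inner_map_map]

theorem refl_neg {α : V} {g : V ≃ₗᵢ[ℝ] V} (hg : reflFormula α g) : reflFormula (-α) g := by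
  intro v
  rw [hg v]
  simp [neg_div]

theorem refl_fix {α : V} (hα : α ≠ 0) {g : V ≃ₗᵢ[ℝ] V} (hg : reflFormula α g) {v : V}
    (h : g v = v) : ⟪α, v⟫ = 0 := by
  have h1 := hg v
  rw [h, eq_comm, sub_eq_self, smul_eq_zero] at h1
  have h2 : ⟪α, α⟫ ≠ 0 := by simpa using hα
  rcases h1 with h1 | h1
  · rw [div_eq_zero_iff] at h1
    rcases h1 with h1 | h1
    · linarith
    · exact absurd h1 h2
  · exact absurd h1 hα

theorem prod_sub_mem {βs : List V} {L : List (V ≃ₗᵢ[ℝ] V)} (h : List.Forall₂ reflFormula βs L)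
    (v : V) : L.prod v - v ∈ Submodule.span ℝ {x | x ∈ βs} := by
  induction h with
  | nil => simp
  | @cons b g bs gs hb _ ih =>
    rw [List.prod_cons, lie_mul_apply, hb]
    have e : ∀ c : ℝ, gs.prod v - c • b - v = (gs.prod v - v) - c • b := fun c => by abel
    rw [e]
    refine Submodule.sub_mem _ (Submodule.span_mono ?_ ih)
      (Submodule.smul_mem _ _ (Submodule.subset_span (by simp)))
    intro x hx
    exact List.mem_cons_of_mem _ hx

theorem prod_fix {βs : List V} {L : List (V ≃ₗᵢ[ℝ] V)} (h : List.Forall₂ reflFormula βs L)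
    (v : V) (hv : ∀ b ∈ βs, ⟪b, v⟫ = 0) : L.prod v = v := by
  induction h with
  | nil => simp
  | @cons b g bs gs hb _ ih =>
    rw [List.prod_cons, lie_mul_apply,
      ih (fun b' hb' => hv b' (List.mem_cons_of_mem _ hb')), hb, hv b (by simp)]
    simp

/-- Linear independence of a list, recursively. -/
def goodList : List V → Prop
  | [] => True
  | b :: l => b ∉ Submodule.span ℝ {x | x ∈ l} ∧ goodList l

theorem good_fix {βs : List V} {L : List (V ≃ₗᵢ[ℝ] V)} (h : List.Forall₂ reflFormula βs L)
    (hgood : goodList βs) (v : V) (hv : L.prod v = v) : ∀ b ∈ βs, ⟪b, v⟫ = 0 := by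
  induction h with
  | nil => simp
  | @cons b g bs gs hb hbs ih =>
    obtain ⟨h1, h2⟩ := hgood
    rw [List.prod_cons, lie_mul_apply] at hv
    have hb0 : b ≠ 0 := by
      rintro rfl
      exact h1 (Submodule.zero_mem _)
    have hmem := prod_sub_mem hbs v
    have e := hb (gs.prod v)
    rw [hv] at e
    have e2 : gs.prod v - v = (2 * ⟪b, gs.prod v⟫ / ⟪b, b⟫) • b := by
      nth_rewrite 2 [e]
      abel
    have hc : (2 * ⟪b, gs.prod v⟫ / ⟪b, b⟫) = 0 := by
      by_contra hc
      apply h1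
      rw [e2] at hmem
      exact (Submodule.smul_mem_iff _ hc).1 hmem
    rw [hc, zero_smul, sub_eq_zero] at e2
    rw [e2] at hv
    intro x hx
    rcases List.mem_cons.1 hx with rfl | hx
    · exact refl_fix hb0 hb hv
    · exact ih h2 e2 x hx

theorem good_le_finrank [FiniteDimensional ℝ V] {βs : List V} (h : goodList βs) :
    βs.length ≤ finrank ℝ (Submodule.span ℝ {x | x ∈ βs}) := by
  induction βs with
  | nil => simp
  | cons b l ih =>
    have h1 := ih h.2
    have hlt : Submodule.span ℝ {x | x ∈ l} < Submodule.span ℝ {x | x ∈ b :: l} := by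
      refine lt_of_le_of_ne (Submodule.span_mono fun x hx => List.mem_cons_of_mem _ hx) ?_
      intro e
      apply h.1
      rw [e]
      exact Submodule.subset_span (by simp)
    have := Submodule.finrank_lt_finrank_of_lt hlt
    rw [List.length_cons]
    omega

theorem finrank_le_length {βs : List V} :
    finrank ℝ (Submodule.span ℝ {x | x ∈ βs}) ≤ βs.length := by
  classical
  have : {x | x ∈ βs} = (βs.toFinset : Set V) := by ext; simp
  rw [this]
  exact (finrank_span_finset_le_card _).trans (List.toFinset_card_le _)

theorem good_length_le [FiniteDimensional ℝ V] {βs αs : List V} {L M : List (V ≃ₗᵢ[ℝ] V)}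
    (hL : List.Forall₂ reflFormula βs L) (hgood : goodList βs)
    (hM : List.Forall₂ reflFormula αs M) (e : L.prod = M.prod) : βs.length ≤ αs.length := by
  have hle : Submodule.span ℝ {x | x ∈ βs} ≤ Submodule.span ℝ {x | x ∈ αs} := by
    rw [← Submodule.orthogonal_le_orthogonal_iff]
    intro v hv
    have hv' : ∀ a ∈ αs, ⟪a, v⟫ = 0 := fun a ha =>
      (Submodule.mem_orthogonal _ _).1 hv a (Submodule.subset_span ha)
    have h2 := good_fix hL hgood v (by rw [e]; exact prod_fix hM v hv')
    rw [Submodule.mem_orthogonal]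
    intro u hu
    induction hu using Submodule.span_induction with
    | mem x hx => exact h2 x hx
    | zero => simp
    | add x y _ _ hx hy => rw [inner_add_left, hx, hy, add_zero]
    | smul c x _ hx => rw [inner_smul_left, hx, mul_zero]
  exact (good_le_finrank hgood).trans ((Submodule.finrank_mono hle).trans finrank_le_length)

theorem good_map {ι : Type*} {σ : ι → V} (hσ : LinearIndependent ℝ σ) {l : List ι}
    (hl : l.Nodup) : goodList (l.map σ) := by
  induction l with
  | nil => trivial
  | cons i l ih =>
    rw [List.nodup_cons] at hl
    refine ⟨?_, ih hl.2⟩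
    have : {x | x ∈ l.map σ} = σ '' {j | j ∈ l} := by ext; simp
    rw [this]
    exact hσ.notMem_span_image (by simpa using hl.1)

theorem forall2_map {ι : Type*} {W : Subgroup (V ≃ₗᵢ[ℝ] V)} {σ : ι → V} {t : ι → W}
    (ht : ∀ i, reflFormula (σ i) (t i).1) (l : List ι) :
    List.Forall₂ reflFormula (l.map σ) (l.map (fun i => (t i).1)) := by
  induction l with
  | nil => simp
  | cons i l ih => exact List.Forall₂.cons (ht i) ih

theorem coe_prod_map {ι : Type*} {W : Subgroup (V ≃ₗᵢ[ℝ] V)} (t : ι → W) (l : List ι) :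
    ((l.map t).prod).1 = (l.map (fun i => (t i).1)).prod := by
  induction l with
  | nil => simp
  | cons i l ih =>
    rw [List.map_cons, List.prod_cons, List.map_cons, List.prod_cons, ← ih]
    rfl

theorem exists_roots {W : Subgroup (V ≃ₗᵢ[ℝ] V)} (L : List W)
    (h : ∀ t ∈ L, IsReflection (t : W).1) :
    ∃ αs : List V, αs.length = L.length ∧ 
      List.Forall₂ reflFormula αs (L.map (fun i => i.1)) := by
  induction L with
  | nil => exact ⟨[], by simp⟩
  | cons g L ih =>
    obtain ⟨αs, h1, h2⟩ := ih (fun t ht => h t (List.mem_cons_of_mem _ ht))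
    obtain ⟨a, _, ha⟩ := h g (by simp)
    exact ⟨a :: αs, by simp [h1], by simpa using ⟨ha, h2⟩⟩

/-- Lower bound on the length of reflection factorisations. -/
theorem length_le_of_prod [FiniteDimensional ℝ V] {W : Subgroup (V ≃ₗᵢ[ℝ] V)}
    {βs : List V} {M : List (V ≃ₗᵢ[ℝ] V)}
    (hM : List.Forall₂ reflFormula βs M) (hgood : goodList βs) (L : List W)
    (h : ∀ t ∈ L, IsReflection (t : W).1) (e : L.prod.1 = M.prod) : βs.length ≤ L.length := by
  obtain ⟨αs, h1, h2⟩ := exists_roots L h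
  rw [← h1]
  refine good_length_le hM hgood h2 ?_
  rw [← e]
  simpa using coe_prod_map (fun i : W => i) L

theorem refl_inv {g : V ≃ₗᵢ[ℝ] V} (h : IsReflection g) : g⁻¹ = g := by
  obtain ⟨a, ha, hg⟩ := h
  rw [inv_eq_iff_mul_eq_one]
  ext v
  have h2 : ⟪a, a⟫ ≠ 0 := by simpa using ha
  rw [lie_mul_apply, hg (g v), hg v, inner_sub_right, inner_smul_right,
    sub_sub, ← add_smul]
  have : 2 * ⟪a, v⟫ / ⟪a, a⟫ + 2 * (⟪a, v⟫ - 2 * ⟪a, v⟫ / ⟪a, a⟫ * ⟪a, a⟫) / ⟪a, a⟫ = 0 := by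
    field_simp
    ring
  rw [this]
  simp

theorem exists_factor {W : Subgroup (V ≃ₗᵢ[ℝ] V)} (hW : IsReflectionGroup W) (w : W) :
    ∃ L : List W, (∀ t ∈ L, IsReflection (t : W).1) ∧ L.prod = w := by
  have key : ∀ g ∈ Subgroup.closure {g | g ∈ W ∧ IsReflection g},
      ∃ L : List W, (∀ t ∈ L, IsReflection (t : W).1) ∧ L.prod.1 = g := by
    intro g hg
    induction hg using Subgroup.closure_induction with
    | mem x hx => exact ⟨[⟨x, hx.1⟩], by simpa using hx.2, by simp⟩
    | one => exact ⟨[], by simp, by simp⟩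
    | mul x y _ _ hx hy =>
      obtain ⟨L, h1, h2⟩ := hx
      obtain ⟨M, h3, h4⟩ := hy
      refine ⟨L ++ M, ?_, by simp [← h2, ← h4]⟩
      intro t ht
      rcases List.mem_append.1 ht with ht | ht
      · exact h1 t ht
      · exact h3 t ht
    | inv x _ hx =>
      obtain ⟨L, h1, h2⟩ := hx
      have hinv : ∀ L : List W, (∀ t ∈ L, IsReflection (t : W).1) →
          L.reverse.prod = L.prod⁻¹ := by
        intro L
        induction L with
        | nil => simp
        | cons g L ih =>
          intro h
          have hg : g⁻¹ = g := Subtype.ext (refl_inv (h g (by simp)))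
          rw [List.reverse_cons, List.prod_append, ih (fun t ht => h t (List.mem_cons_of_mem _ ht))]
          simp [hg]
      refine ⟨L.reverse, by simpa using h1, ?_⟩
      rw [hinv L h1, ← h2]
      rfl
  rw [hW.2] at key
  obtain ⟨L, h1, h2⟩ := key w.1 w.2
  exact ⟨L, h1, Subtype.ext h2⟩

theorem refLen_attained {W : Subgroup (V ≃ₗᵢ[ℝ] V)} (hW : IsReflectionGroup W) (w : W) :
    ∃ L : List W, L.length = refLen W w ∧ (∀ t ∈ L, IsReflection (t : W).1) ∧ L.prod = w := by
  obtain ⟨L, h1, h2⟩ := exists_factor hW w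
  exact Nat.sInf_mem (s := {k | ∃ l : List W, l.length = k ∧
    (∀ t ∈ l, IsReflection (t : W).1) ∧ l.prod = w}) ⟨_, L, rfl, h1, h2⟩

theorem refLen_prod [FiniteDimensional ℝ V] {W : Subgroup (V ≃ₗᵢ[ℝ] V)}
    (hW : IsReflectionGroup W) {ι : Type*} {σ : ι → V} (hσ : LinearIndependent ℝ σ) {t : ι → W}
    (ht : ∀ i, reflFormula (σ i) (t i).1) {l : List ι} (hl : l.Nodup) :
    refLen W (l.map t).prod = l.length := by
  apply le_antisymm
  · refine Nat.sInf_le ⟨l.map t, by simp, ?_, rfl⟩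
    intro x hx
    obtain ⟨i, _, rfl⟩ := List.mem_map.1 hx
    exact ⟨σ i, hσ.ne_zero i, ht i⟩
  · obtain ⟨L, h1, h2, h3⟩ := refLen_attained hW (l.map t).prod
    rw [← h1]
    simpa using length_le_of_prod (forall2_map ht l) (good_map hσ hl) L h2
      (by rw [h3, coe_prod_map])

/-- A simple reflection makes only its own simple root negative. -/
theorem simple_neg {W : Subgroup (V ≃ₗᵢ[ℝ] V)} {Φ : Set V} (hΦ : IsRootSystemFor W Φ)
    {n : ℕ} {σ : Fin n → V} (hσ : IsSimpleSystem Φ σ) {f : V →ₗ[ℝ] ℝ} (hf : ∀ i, f (σ i) = 1)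
    {i : Fin n} {s : W} (hs : reflFormula (σ i) s.1) {x : V} (hx : x ∈ Φ) (hpos : 0 < f x)
    (hneg : f (s.1 x) < 0) : x = σ i := by
  have hsum : ∀ c : Fin n → ℝ, f (∑ i, c i • σ i) = ∑ i, c i := fun c => by simp [hf]
  obtain ⟨c, hc, hxc⟩ : ∃ c : Fin n → ℝ, (∀ i, 0 ≤ c i) ∧ x = ∑ i, c i • σ i := by
    rcases hσ.2.2 x hx with h | ⟨c, hc, h⟩
    · exact h
    · exfalso
      have h1 := hsum c
      rw [← h, map_neg] at h1
      have := Finset.sum_nonneg (s := Finset.univ) (fun i _ => hc i)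
      linarith
  obtain ⟨d, hd, hyd⟩ : ∃ c : Fin n → ℝ, (∀ i, 0 ≤ c i) ∧ -(s.1 x) = ∑ i, c i • σ i := by
    rcases hσ.2.2 _ (hΦ.2.2.2.2.2.2 s.1 s.2 x hx) with ⟨c, hc, h⟩ | h
    · exfalso
      have h1 := hsum c
      rw [← h] at h1
      have := Finset.sum_nonneg (s := Finset.univ) (fun i _ => hc i)
      linarith
    · exact h
  have hli := Fintype.linearIndependent_iff.1 hσ.2.1
  set a := 2 * ⟪σ i, x⟫ / ⟪σ i, σ i⟫ with ha
  have hz : ∑ j, (c j + d j - if j = i then a else 0) • σ j = 0 := by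
    simp only [sub_smul, add_smul, Finset.sum_sub_distrib, Finset.sum_add_distrib, ite_smul,
      zero_smul]
    rw [← hxc, ← hyd, hs x, ← ha]
    simp
  have hz' := hli _ hz
  have hxi : x = c i • σ i := by
    rw [hxc]
    apply Finset.sum_eq_single i
    · intro j _ hj
      have := hz' j
      rw [if_neg hj] at this
      have : c j = 0 := by linarith [hc j, hd j]
      rw [this, zero_smul]
    · simp
  have h1 := hΦ.2.2.2.1 (σ i) (hσ.1 i) (c i) (hxi ▸ hx)
  rcases h1 with h1 | h1
  · rw [hxi, h1, one_smul]
  · linarith [hc i]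

theorem split_neg {W : Subgroup (V ≃ₗᵢ[ℝ] V)} {Φ : Set V} (hΦ : IsRootSystemFor W Φ)
    {n : ℕ} {σ : Fin n → V} (hσ : IsSimpleSystem Φ σ) {f : V →ₗ[ℝ] ℝ} (hf : ∀ i, f (σ i) = 1)
    (hf0 : ∀ x ∈ Φ, f x ≠ 0)
    {t : Fin n → W} (ht : ∀ i, reflFormula (σ i) (t i).1) {x : V} (hx : x ∈ Φ) (hpos : 0 < f x)
    (l : List (Fin n)) (hneg : f ((l.map t).prod.1 x) < 0) :
    ∃ l1 i l2, l = l1 ++ i :: l2 ∧ (l2.map t).prod.1 x = σ i := by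
  induction l with
  | nil => simp at hneg; linarith
  | cons j l ih =>
    have hy : (l.map t).prod.1 x ∈ Φ := hΦ.2.2.2.2.2.2 _ (l.map t).prod.2 x hx
    rcases lt_or_gt_of_ne (hf0 _ hy) with h | h
    · obtain ⟨l1, i, l2, e, h2⟩ := ih h
      exact ⟨j :: l1, i, l2, by simp [e], h2⟩
    · refine ⟨[], j, l, rfl, simple_neg hΦ hσ hf (ht j) hy h ?_⟩
      simpa using hneg

theorem height_ne {Φ : Set V} (h0 : ∀ α ∈ Φ, α ≠ 0)
    {n : ℕ} {σ : Fin n → V} (hσ : IsSimpleSystem Φ σ) {f : V →ₗ[ℝ] ℝ} (hf : ∀ i, f (σ i) = 1) :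
    ∀ x ∈ Φ, f x ≠ 0 := by
  have key : ∀ (x : V) (c : Fin n → ℝ), (∀ i, 0 ≤ c i) → x = ∑ i, c i • σ i → f x = 0 →
      x = 0 := by
    intro x c hc e h
    rw [e] at h
    simp only [map_sum, map_smul, hf, smul_eq_mul, mul_one] at h
    rw [Finset.sum_eq_zero_iff_of_nonneg (fun i _ => hc i)] at h
    rw [e]
    exact Finset.sum_eq_zero fun i hi => by rw [h i hi, zero_smul]
  intro x hx h
  apply h0 x hx
  rcases hσ.2.2 x hx with ⟨c, hc, e⟩ | ⟨c, hc, e⟩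
  · exact key x c hc e h
  · exact neg_eq_zero.1 (key _ c hc e (by simp [h]))

/-- Data of a parabolic Coxeter element of rank `m`. -/
def ParCox (W : Subgroup (V ≃ₗᵢ[ℝ] V)) (Φ : Set V) (ℓ m : ℕ) (w : W) : Prop :=
  ∃ σ : Fin ℓ → V, IsSimpleSystem Φ σ ∧
    ∃ t : Fin ℓ → W, (∀ i, reflFormula (σ i) (t i).1) ∧
      ∃ l : List (Fin ℓ), l.Nodup ∧ l.length = m ∧ (l.map t).prod = w

theorem ParCox.conj {W : Subgroup (V ≃ₗᵢ[ℝ] V)} {Φ : Set V} (hΦ : IsRootSystemFor W Φ)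
    {ℓ m : ℕ} {w : W} (h : ParCox W Φ ℓ m w) (g : W) : ParCox W Φ ℓ m (g * w * g⁻¹) := by
  obtain ⟨σ, hσ, t, ht, l, hl, hm, hw⟩ := h
  refine ⟨fun i => g.1 (σ i), ⟨fun i => hΦ.2.2.2.2.2.2 _ g.2 _ (hσ.1 i), ?_, ?_⟩,
    fun i => g * t i * g⁻¹, fun i => refl_conj (ht i) g.1, l, hl, hm, ?_⟩
  · exact hσ.2.1.map' g.1.toLinearEquiv.toLinearMap (LinearEquiv.ker _)
  · intro α hα
    have hg : g.1 ((g⁻¹ : W).1 α) = α := by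
      rw [← lie_mul_apply]; simp
    rcases hσ.2.2 _ (hΦ.2.2.2.2.2.2 _ (g⁻¹ : W).2 α hα) with ⟨c, hc, e⟩ | ⟨c, hc, e⟩
    · left
      refine ⟨c, hc, ?_⟩
      rw [← hg, e]
      simp
    · right
      refine ⟨c, hc, ?_⟩
      rw [← hg, ← map_neg, e]
      simp
  · rw [← hw]
    clear hl hm hw
    induction l with
    | nil => simp
    | cons i l ih =>
      simp only [List.map_cons, List.prod_cons, ih]
      group

theorem ParCox.mul_refl [FiniteDimensional ℝ V] {W : Subgroup (V ≃ₗᵢ[ℝ] V)}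
    (hW : IsReflectionGroup W) {Φ : Set V} (hΦ : IsRootSystemFor W Φ)
    {m : ℕ} {w : W} (h : ParCox W Φ (finrank ℝ V) m w) {r : W} (hr : IsReflection r.1)
    (L : List W) (hL : ∀ t ∈ L, IsReflection (t : W).1) (hLp : L.prod = w * r)
    (hLm : L.length ≤ m) : ∃ m', m = m' + 1 ∧ ParCox W Φ (finrank ℝ V) m' (w * r) := by
  obtain ⟨σ, hσ, t, ht, l, hl, hm, hw⟩ := h
  obtain ⟨β, hβ, hrβ⟩ := hΦ.2.2.2.2.2.1 r.1 r.2 hr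
  have hF := forall2_map ht l
  have hG := good_map hσ.2.1 hl
  have hwc : w.1 = (l.map (fun i => (t i).1)).prod := by rw [← hw, coe_prod_map]
  set S := Submodule.span ℝ {x | x ∈ l.map σ} with hS
  have hsub : ∀ v, w.1 v - v ∈ S := fun v => by
    rw [hwc]; exact prod_sub_mem hF v
  -- the root of `r` lies in the span
  have hmem : β ∈ S := by
    by_contra hn
    have hn' : w.1 β ∉ S := by
      intro h1
      apply hn
      have := S.sub_mem h1 (hsub β)
      simpa using this
    have := length_le_of_prod (W := W) (List.Forall₂.cons (refl_conj hrβ w.1) hF) ⟨hn', hG⟩ L hL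
      (by rw [hLp, List.prod_cons, ← hwc]; simp)
    simp at this
    omega
  -- height function
  let b : Basis (Fin (finrank ℝ V)) ℝ V :=
    basisOfLinearIndependentOfCardEqFinrank' σ hσ.2.1 (by simp)
  have hb : ∀ i, b i = σ i := fun i => by simp [b]
  let f : V →ₗ[ℝ] ℝ := b.constr ℝ (fun _ => (1 : ℝ))
  have hf : ∀ i, f (σ i) = 1 := fun i => by
    rw [← hb]; exact b.constr_basis ℝ _ i
  have hf0 := height_ne hΦ.2.1 hσ hf
  -- choose positive root
  obtain ⟨β, hβ, hrβ, hmem, hpos⟩ :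
      ∃ β ∈ Φ, reflFormula β r.1 ∧ β ∈ S ∧ 0 < f β := by
    rcases lt_or_gt_of_ne (hf0 β hβ) with h | h
    · exact ⟨-β, hΦ.2.2.1 β hβ, refl_neg hrβ, S.neg_mem hmem, by simpa using h⟩
    · exact ⟨β, hβ, hrβ, hmem, h⟩
  have hroot : ∀ k : ℕ, (w ^ k).1 β ∈ Φ := fun k => hΦ.2.2.2.2.2.2 _ (w ^ k).2 β hβ
  have hstep : ∀ k : ℕ, (w ^ (k + 1)).1 β = w.1 ((w ^ k).1 β) := fun k => by
    rw [← lie_mul_apply, pow_succ']; rfl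
  have hspan : ∀ k : ℕ, (w ^ k).1 β ∈ S := by
    intro k
    induction k with
    | zero => simpa using hmem
    | succ k ih =>
      rw [hstep]
      have := S.add_mem (hsub ((w ^ k).1 β)) ih
      simpa using this
  obtain ⟨k, hk1, hk2⟩ : ∃ k : ℕ, 0 < f ((w ^ k).1 β) ∧ f (w.1 ((w ^ k).1 β)) < 0 := by
    by_contra hcon
    push Not at hcon
    have hall : ∀ k : ℕ, 0 < f ((w ^ k).1 β) := by
      intro k
      induction k with
      | zero => simpa using hpos
      | succ k ih =>
        have h1 := hcon k ih
        have h2 := hf0 _ (hroot (k + 1))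
        rw [hstep] at h2 ⊢
        exact lt_of_le_of_ne h1 h2.symm
    haveI := hW.1
    have hN : 0 < orderOf w := orderOf_pos w
    set N := orderOf w with hNdef
    set T := ∑ k ∈ Finset.range N, (w ^ k).1 β with hT
    have hTpos : 0 < f T := by
      rw [hT, map_sum]
      exact Finset.sum_pos (fun k _ => hall k) ⟨0, by simpa using hN⟩
    have hTS : T ∈ S := Submodule.sum_mem _ fun k _ => hspan k
    have hTfix : w.1 T = T := by
      have h1 : w.1 T = ∑ k ∈ Finset.range N, (w ^ (k + 1)).1 β := by
        rw [hT, map_sum]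
        exact Finset.sum_congr rfl fun k _ => (hstep k).symm
      have h2 := Finset.sum_range_succ (fun k => (w ^ k).1 β) N
      rw [Finset.sum_range_succ'] at h2
      have h3 : w ^ N = w ^ 0 := by rw [hNdef, pow_orderOf_eq_one, pow_zero]
      rw [h3] at h2
      rw [h1]
      exact add_right_cancel h2
    have horth := good_fix hF hG T (by rw [← hwc]; exact hTfix)
    have hT0 : ∀ u ∈ S, ⟪u, T⟫ = 0 := by
      intro u hu
      induction hu using Submodule.span_induction with
      | mem x hx => exact horth x hx
      | zero => simp
      | add x y _ _ hx hy => rw [inner_add_left, hx, hy, add_zero]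
      | smul c x _ hx => rw [inner_smul_left, hx, mul_zero]
    have : T = 0 := inner_self_eq_zero.1 (hT0 T hTS)
    rw [this, map_zero] at hTpos
    exact lt_irrefl _ hTpos
  obtain ⟨l1, i, l2, el, hi⟩ :=
    split_neg hΦ hσ hf hf0 ht (hroot k) hk1 l (by rw [hw]; exact hk2)
  set g := w ^ k with hg
  set p := (l2.map t).prod with hp
  have hconj : p * (g * r * g⁻¹) * p⁻¹ = t i := by
    apply Subtype.ext
    have h1 := refl_conj (refl_conj hrβ g.1) p.1
    rw [hi] at h1
    exact refl_unique h1 (ht i)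
  have htt : t i * t i = 1 := by
    apply Subtype.ext
    have := refl_inv ⟨σ i, hσ.2.1.ne_zero i, ht i⟩
    rw [inv_eq_iff_mul_eq_one] at this
    exact this
  have hw' : w = (l1.map t).prod * (t i * p) := by
    rw [← hw, el, List.map_append, List.prod_append, List.map_cons, List.prod_cons]
  have hprod : w * (g * r * g⁻¹) = ((l1 ++ l2).map t).prod := by
    have h1 : p * (g * r * g⁻¹) = t i * p := by rw [← hconj]; group
    rw [hw', List.map_append, List.prod_append, mul_assoc, mul_assoc, h1, ← mul_assoc (t i), htt,
      one_mul]
  have hnd : (l1 ++ l2).Nodup := by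
    rw [el] at hl
    exact hl.sublist ((List.Sublist.refl l1).append (List.sublist_cons_self i l2))
  have hfin : ParCox W Φ (finrank ℝ V) (l1 ++ l2).length (w * (g * r * g⁻¹)) :=
    ⟨σ, hσ, t, ht, l1 ++ l2, hnd, rfl, hprod.symm⟩
  refine ⟨(l1 ++ l2).length, by rw [← hm, el]; simp; omega, ?_⟩
  have h2 := hfin.conj hΦ g⁻¹
  have hcomm : g⁻¹ * w = w * g⁻¹ := by
    rw [hg]
    exact ((Commute.refl w).pow_right k).inv_right.eq.symm
  have h3 : g⁻¹ * (w * (g * r * g⁻¹)) * (g⁻¹)⁻¹ = w * r := by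
    rw [← mul_assoc, hcomm]; group
  rwa [h3] at h2

theorem ParCox.descend [FiniteDimensional ℝ V] {W : Subgroup (V ≃ₗᵢ[ℝ] V)}
    (hW : IsReflectionGroup W) {Φ : Set V} (hΦ : IsRootSystemFor W Φ) {w : W}
    (L0 : List W) (hL0 : ∀ t ∈ L0, IsReflection (t : W).1) (hL0p : L0.prod = w)
    (L : List W) : ∀ (m : ℕ) (_ : ∀ t ∈ L, IsReflection (t : W).1)
    (_ : ParCox W Φ (finrank ℝ V) m (w * L.prod)) (_ : L0.length + L.length ≤ m),
    ∃ m', ParCox W Φ (finrank ℝ V) m' w := by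
  induction L using List.reverseRecOn with
  | nil => intro m _ h _; exact ⟨m, by simpa using h⟩
  | append_singleton L r ih =>
    intro m hL h hm
    have hr : IsReflection r.1 := hL r (by simp)
    have hL' : ∀ t ∈ L, IsReflection (t : W).1 := fun t ht => hL t (by simp [ht])
    have hrr : r * r = 1 := by
      apply Subtype.ext
      have := refl_inv hr
      rw [inv_eq_iff_mul_eq_one] at this
      exact this
    have e : w * (L ++ [r]).prod * r = w * L.prod := by
      simp [mul_assoc, hrr]
    simp at hm
    obtain ⟨m', hm', h'⟩ := h.mul_refl hW hΦ hr (L0 ++ L) (by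
      intro t ht
      rcases List.mem_append.1 ht with ht | ht
      · exact hL0 t ht
      · exact hL' t ht) (by rw [e, List.prod_append, hL0p]) (by simp; omega)
    rw [e] at h'
    exact ih m' hL' h' (by omega)

end Helpers

/-- `w ⪯ γ` for some Coxeter element `γ` of `W` if and only if `w` is a parabolic
Coxeter element of `W`. -/
theorem statement15 {V : Type*} [NormedAddCommGroup V] [InnerProductSpace ℝ V]
    [FiniteDimensional ℝ V]
    (W : Subgroup (V ≃ₗᵢ[ℝ] V)) (hW : IsReflectionGroup W)
    (Φ : Set V) (hΦ : IsRootSystemFor W Φ) (w : W) :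
    (∃ γ : W, IsCoxeterElement W Φ (Module.finrank ℝ V) γ ∧ absLe W w γ) ↔
      IsParabolicCoxeterElement W Φ (Module.finrank ℝ V) w := by
  constructor
  · rintro ⟨γ, ⟨σ, hσ, t, ht, l, hl, _, hγ⟩, hle⟩
    have hlen := refLen_prod hW hσ.2.1 ht hl
    rw [hγ] at hlen
    unfold absLe at hle
    obtain ⟨L0, h1, h2, h3⟩ := refLen_attained hW w
    obtain ⟨L, h4, h5, h6⟩ := refLen_attained hW (w⁻¹ * γ)
    obtain ⟨m', σ', hσ', t', ht', l', hl', _, hw'⟩ :=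
      ParCox.descend hW hΦ L0 h2 h3 L l.length h5
        ⟨σ, hσ, t, ht, l, hl, rfl, by rw [h6, hγ]; group⟩ (by omega)
    exact ⟨σ', hσ', t', ht', l', hl', hw'⟩
  · rintro ⟨σ, hσ, t, ht, l, hl, hw⟩
    classical
    set l2 := (List.finRange (finrank ℝ V)).filter (fun i => i ∉ l) with hl2
    have hnd2 : l2.Nodup := (List.nodup_finRange _).filter _
    have hnd : (l ++ l2).Nodup := by
      rw [List.nodup_append']
      refine ⟨hl, hnd2, ?_⟩
      intro a ha hb
      simp [hl2] at hb
      exact hb ha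
    refine ⟨((l ++ l2).map t).prod, ⟨σ, hσ, t, ht, l ++ l2, hnd, ?_, rfl⟩, ?_⟩
    · intro i
      by_cases h : i ∈ l <;> simp [hl2, h]
    · unfold absLe
      have e : w⁻¹ * ((l ++ l2).map t).prod = (l2.map t).prod := by
        rw [List.map_append, List.prod_append, hw]; group
      rw [e, ← hw, refLen_prod hW hσ.2.1 ht hl, refLen_prod hW hσ.2.1 ht hnd2,
        refLen_prod hW hσ.2.1 ht hnd, List.length_append]
end

section
/- The braid group (Artin group of type A_{ℓ−1}) acts transitively by Hurwitz moves on the set of shortest factorizations of a Coxeter element γ of W into reflections, where the i-th generator replaces (t₁,...,t_i, t_{i+1},...,t_ℓ) by (t₁,...,t_i t_{i+1} t_i, t_i,...,t_ℓ). -/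
open scoped RealInnerProductSpace
open Module

/-- A single Hurwitz move on a tuple (list) of group elements: some adjacent pair
`(s, t)` is replaced by `(s * t * s, s)`. -/
def HurwitzStep {G : Type*} [Group G] (l₁ l₂ : List G) : Prop :=
  ∃ (a b : List G) (s t : G), l₁ = a ++ s :: t :: b ∧ l₂ = a ++ (s * t * s) :: s :: b


open scoped RealInnerProductSpace

namespace Hur

def R {G : Type*} [Group G] : List G → List G → Prop :=
  Relation.ReflTransGen (fun x y => HurwitzStep x y ∨ HurwitzStep y x)

section grp
variable {G : Type*} [Group G]

theorem R.symm {x y : List G} (h : R x y) : R y x := by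
  have : Std.Symm (fun x y : List G => HurwitzStep x y ∨ HurwitzStep y x) := ⟨fun _ _ => Or.symm⟩
  exact Relation.ReflTransGen.stdSymm.symm _ _ h

theorem R.trans {x y z : List G} (h : R x y) (h' : R y z) : R x z :=
  Relation.ReflTransGen.trans h h'

theorem R.self (x : List G) : R x x := Relation.ReflTransGen.refl

theorem step_app {x y : List G} (a b : List G) (h : HurwitzStep x y) :
    HurwitzStep (a ++ x ++ b) (a ++ y ++ b) := by
  obtain ⟨c, d, s, t, rfl, rfl⟩ := h
  exact ⟨a ++ c, d ++ b, s, t, by simp, by simp⟩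

theorem R.app {x y : List G} (a b : List G) (h : R x y) : R (a ++ x ++ b) (a ++ y ++ b) :=
  by
  induction h with
  | refl => exact Relation.ReflTransGen.refl
  | tail _ h2 ih => exact ih.tail (h2.imp (step_app a b) (step_app a b))

theorem R.move1 (a b : List G) (s t : G) : R (a ++ s :: t :: b) (a ++ (s * t * s) :: s :: b) :=
  Relation.ReflTransGen.single (Or.inl ⟨a, b, s, t, rfl, rfl⟩)

theorem R.move2 (a b : List G) (s t : G) (ht : t * t = 1) :
    R (a ++ s :: t :: b) (a ++ t :: (t * s * t) :: b) := by
  refine Relation.ReflTransGen.single (Or.inr ⟨a, b, t, t * s * t, rfl, ?_⟩)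
  have : t * (t * s * t) * t = s := by
    calc t * (t * s * t) * t = (t * t) * s * (t * t) := by group
      _ = s := by simp [ht]
  rw [this]

theorem R.shift (b : List G) (hb : ∀ t ∈ b, t * t = 1) : ∀ s : G,
    R (s :: b) (b ++ [b.prod⁻¹ * s * b.prod]) := by
  induction b with
  | nil => intro s; simpa using R.self [s]
  | cons u b ih =>
    intro s
    have hu : u * u = 1 := hb u (by simp)
    have h1 := R.move2 [] b s u hu
    have h2 := (ih (fun t ht => hb t (by simp [ht])) (u * s * u)).app [u] []
    refine R.trans h1 ?_
    have hu' : u⁻¹ = u := inv_eq_of_mul_eq_one_left hu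
    simpa [mul_assoc, hu'] using h2

/-- invariants of Hurwitz moves -/
theorem R.inv {x y : List G} (h : R x y) (P : G → Prop) (hP : ∀ t, P t → t * t = 1)
    (hc : ∀ s t, P s → P t → P (s * t * s)) (hx : ∀ t ∈ x, P t) :
    (∀ t ∈ y, P t) ∧ y.length = x.length ∧ y.prod = x.prod := by
  induction h with
  | refl => exact ⟨hx, rfl, rfl⟩
  | tail _ h2 ih =>
    obtain ⟨i1, i2, i3⟩ := ih
    rcases h2 with ⟨a, b, s, t, rfl, rfl⟩ | ⟨a, b, s, t, rfl, rfl⟩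
    · have hs := i1 s (by simp)
      have ht := i1 t (by simp)
      refine ⟨?_, by simpa using i2, ?_⟩
      · intro z hz
        simp only [List.mem_append, List.mem_cons] at hz i1
        rcases hz with hz | rfl | rfl | hz
        · exact i1 z (by simp [hz])
        · exact hc _ _ hs ht
        · exact hs
        · exact i1 z (by simp [hz])
      · rw [← i3]
        have : s * (s * (b.prod)) = b.prod := by rw [← mul_assoc, hP s hs, one_mul]
        simp [mul_assoc, this]
    · have hs := i1 s (by simp)
      have ht := i1 (s * t * s) (by simp)
      refine ⟨?_, by simpa using i2, ?_⟩
      · intro z hz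
        simp only [List.mem_append, List.mem_cons] at hz i1
        rcases hz with hz | rfl | rfl | hz
        · exact i1 z (by simp [hz])
        · exact hs
        · have := hc _ _ hs ht
          have e : s * (s * z * s) * s = z := by
            calc s * (s * z * s) * s = (s * s) * z * (s * s) := by group
              _ = z := by simp [hP s hs]
          rwa [e] at this
        · exact i1 z (by simp [hz])
      · rw [← i3]
        have : s * (s * (b.prod)) = b.prod := by rw [← mul_assoc, hP s hs, one_mul]
        simp [mul_assoc, this]

/-- potential -/
def pot (f : G → ℝ) : G → List G → ℝ
  | _, [] => 0
  | x, t :: l => f (x * t) + pot f (x * t) l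

theorem pot_append (f : G → ℝ) (a l : List G) : ∀ x,
    pot f x (a ++ l) = pot f x a + pot f (x * a.prod) l := by
  induction a with
  | nil => intro x; simp [pot]
  | cons u a ih => intro x; simp [pot, ih, mul_assoc, add_assoc]

/-- Peak removal. -/
theorem exists_mono [Finite G] (f : G → ℝ) (P : G → Prop) (hP : ∀ t, P t → t * t = 1)
    (hc : ∀ s t, P s → P t → P (s * t * s))
    (h0 : ∀ t, P t → f t < f 1)
    (hne : ∀ x t, P t → f (x * t) ≠ f x)
    (hpeak : ∀ u s t, P s → P t → s ≠ t → f u < f (u * s) → f u < f (u * t) →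
      f u < f (u * s * t) ∨ f u < f (u * t * s))
    (l : List G) (hl : ∀ t ∈ l, P t)
    (hmin : ∀ l' : List G, (∀ t ∈ l', P t) → l'.prod = l.prod → l.length ≤ l'.length) :
    ∃ l', R l l' ∧ ∀ a t b, l' = a ++ t :: b → f (a.prod * t) < f a.prod := by
  have hfin : {l' | R l l'}.Finite := by
    refine (List.finite_length_eq G l.length).subset ?_
    intro l' h
    exact (R.inv h P hP hc hl).2.1
  obtain ⟨m, hm, hmax⟩ := Set.exists_max_image {l' | R l l'} (pot f 1) hfin
    ⟨l, Relation.ReflTransGen.refl⟩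
  refine ⟨m, hm, ?_⟩
  obtain ⟨m1, m2, m3⟩ := R.inv hm P hP hc hl
  have nopeak : ∀ a s t b, m = a ++ s :: t :: b → f (a.prod * s) < f a.prod →
      f (a.prod * s * t) < f (a.prod * s) := by
    intro a s t b e hd
    by_contra hcon
    have hs : P s := m1 s (by simp [e])
    have ht : P t := m1 t (by simp [e])
    have hss := hP s hs
    have htt := hP t ht
    have hlt : f (a.prod * s) < f (a.prod * s * t) :=
      lt_of_le_of_ne (not_lt.1 hcon) (hne _ _ ht).symm
    have hst : s ≠ t := by
      rintro rfl
      have := hmin (a ++ b) (fun z hz => m1 z (by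
        rw [e]; simp only [List.mem_append, List.mem_cons] at hz ⊢; tauto)) (by
        rw [← m3, e]
        have : s * (s * (b.prod)) = b.prod := by rw [← mul_assoc, hss, one_mul]
        simp [this])
      rw [← m2, e] at this
      simp at this
    have e1 : a.prod * s * s = a.prod := by rw [mul_assoc, hss, mul_one]
    have key := hpeak (a.prod * s) s t hs ht hst (by rwa [e1]) hlt
    rw [e1] at key
    have e2 : a.prod * (s * t * s) = a.prod * s * t * s := by group
    rcases key with key | key
    · have h1 : R l (a ++ t :: (t * s * t) :: b) := by
        refine R.trans hm ?_
        rw [e]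
        exact R.move2 a b s t htt
      have := hmax _ h1
      have e3 : a.prod * t * (t * s * t) = a.prod * s * t := by
        calc a.prod * t * (t * s * t) = a.prod * (t * t) * s * t := by group
          _ = _ := by simp [htt]
      rw [e, pot_append, pot_append] at this
      simp only [pot, one_mul, e3] at this
      linarith
    · have h1 : R l (a ++ (s * t * s) :: s :: b) := by
        refine R.trans hm ?_
        rw [e]
        exact R.move1 a b s t
      have := hmax _ h1
      have e3 : a.prod * (s * t * s) * s = a.prod * s * t := by
        calc a.prod * (s * t * s) * s = a.prod * s * t * (s * s) := by group
          _ = _ := by simp [hss]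
      rw [e, pot_append, pot_append] at this
      simp only [pot, one_mul, e3] at this
      rw [e2] at this
      linarith
  intro a
  induction a using List.reverseRecOn with
  | nil =>
    intro t b e
    simpa using h0 t (m1 t (by simp [e]))
  | append_singleton a s ih =>
    intro t b e
    have e' : m = a ++ s :: t :: b := by simpa using e
    have := nopeak a s t b e' (ih s (t :: b) e')
    simpa using this

end grp

section geom
variable {V : Type*} [NormedAddCommGroup V] [InnerProductSpace ℝ V]

theorem refl_unit {g : V ≃ₗᵢ[ℝ] V} (h : IsReflection g) :
    ∃ α : V, ⟪α, α⟫ = 1 ∧ ∀ v, g v = v - (2 * ⟪α, v⟫) • α := by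
  obtain ⟨α, h0, h⟩ := h
  have hn : ‖α‖ ≠ 0 := norm_ne_zero_iff.2 h0
  refine ⟨(‖α‖)⁻¹ • α, ?_, ?_⟩
  · rw [real_inner_smul_left, real_inner_smul_right, real_inner_self_eq_norm_sq]
    field_simp
  · intro v
    rw [h v, real_inner_smul_left, real_inner_self_eq_norm_sq, smul_smul]
    congr 2
    field_simp

theorem refl_sq {g : V ≃ₗᵢ[ℝ] V} (h : IsReflection g) : g * g = 1 := by
  obtain ⟨α, h1, h⟩ := refl_unit h
  ext v
  change g (g v) = v
  rw [h (g v), h v, inner_sub_right, real_inner_smul_right, h1]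
  module

theorem refl_conj_formula {g t : V ≃ₗᵢ[ℝ] V} {α : V} (h : reflFormula α t) :
    reflFormula (g α) (g * t * g⁻¹) := by
  intro v
  change g (t (g⁻¹ v)) = _
  have hv : g (g⁻¹ v) = v := by
    change (g * g⁻¹) v = v
    simp
  rw [h, map_sub, map_smul, hv]
  have : ⟪g α, v⟫ = ⟪α, g⁻¹ v⟫ := by
    conv_lhs => rw [← hv]
    exact g.inner_map_map _ _
  rw [this, g.inner_map_map]

theorem formula_unique {s t : V ≃ₗᵢ[ℝ] V} {α : V} (hs : reflFormula α s) (ht : reflFormula α t) :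
    s = t := by
  ext v
  rw [hs v, ht v]

theorem refl_conj {s t : V ≃ₗᵢ[ℝ] V} (hs : IsReflection s) (ht : IsReflection t) :
    IsReflection (s * t * s) := by
  obtain ⟨α, h0, h⟩ := ht
  refine ⟨s α, by simpa using h0, ?_⟩
  have := refl_conj_formula (g := s) h
  rwa [inv_eq_of_mul_eq_one_left (refl_sq hs)] at this

/-- The planar computation. -/
theorem peak_real {p q : V} {s t : V ≃ₗᵢ[ℝ] V} (hs : IsReflection s) (ht : IsReflection t)
    (hst : s ≠ t) (h1 : ⟪p, q⟫ < ⟪s p, q⟫) (h2 : ⟪p, q⟫ < ⟪t p, q⟫) :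
    ⟪p, q⟫ < ⟪s (t p), q⟫ ∨ ⟪p, q⟫ < ⟪t (s p), q⟫ := by
  obtain ⟨α, ha, hs⟩ := refl_unit hs
  obtain ⟨β, hb, ht⟩ := refl_unit ht
  have hc : ⟪α, β⟫ ^ 2 < 1 := by
    by_contra hc
    push Not at hc
    have e : ⟪α - ⟪α, β⟫ • β, α - ⟪α, β⟫ • β⟫ = 1 - ⟪α, β⟫ ^ 2 := by
      simp only [inner_sub_left, inner_sub_right, real_inner_smul_left, real_inner_smul_right,
        ha, hb, real_inner_comm α β]
      ring
    have h0 : α - ⟪α, β⟫ • β = 0 := by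
      rw [real_inner_self_eq_norm_sq] at e
      have h7 : ‖α - ⟪α, β⟫ • β‖ ^ 2 = 0 := le_antisymm (by linarith) (sq_nonneg _)
      simpa using h7
    have hαβ : α = ⟪α, β⟫ • β := sub_eq_zero.1 h0
    have hc1 : ⟪α, β⟫ ^ 2 = 1 := by
      rw [h0, inner_zero_left] at e
      linarith
    apply hst
    ext v
    rw [hs v, ht v]
    generalize ⟪α, β⟫ = c at *
    subst hαβ
    rw [real_inner_smul_left, smul_smul]
    congr 2
    linear_combination (2 * ⟪β, v⟫) * hc1
  rw [hs (t p), ht (s p)]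
  rw [ht p, hs p]
  rw [hs p] at h1
  rw [ht p] at h2
  simp only [inner_sub_left, inner_sub_right, real_inner_smul_left, real_inner_smul_right,
    real_inner_comm α β] at *
  generalize ⟪α, β⟫ = c at *
  generalize ⟪α, p⟫ = a' at *
  generalize ⟪β, p⟫ = b' at *
  generalize ⟪α, q⟫ = a at *
  generalize ⟪β, q⟫ = b at *
  generalize ⟪p, q⟫ = z at *
  by_contra hcon
  push Not at hcon
  obtain ⟨k1, k2⟩ := hcon
  have x1 : 0 < -(a' * a) := by linarith
  have x2 : 0 < -(b' * b) := by linarith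
  have y1 : -(a' * a) + -(b' * b) ≤ -2 * c * b' * a := by linarith
  have y2 : -(a' * a) + -(b' * b) ≤ -2 * c * a' * b := by linarith
  have hm := mul_le_mul y1 y2 (by linarith) (by linarith)
  have hpos : 0 < -(a' * a) * -(b' * b) := mul_pos x1 x2
  nlinarith [sq_nonneg (-(a' * a) - -(b' * b)), mul_pos hpos (sub_pos.2 hc)]

end geom

section main
variable {V : Type*} [NormedAddCommGroup V] [InnerProductSpace ℝ V]
  (W : Subgroup (V ≃ₗᵢ[ℝ] V)) {Φ : Set V}

theorem pos_coef (hΦ : IsRootSystemFor W Φ)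
    {ℓ : ℕ} {σ : Fin ℓ → V} (hσ : IsSimpleSystem Φ σ)
    {ρ : V} (hρ : ∀ i, 0 < ⟪σ i, ρ⟫)
    {α : V} (hα : α ∈ Φ) (h : 0 ≤ ⟪α, ρ⟫) :
    ∃ c : Fin ℓ → ℝ, (∀ i, 0 ≤ c i) ∧ α = ∑ i, c i • σ i := by
  rcases hσ.2.2 α hα with h1 | ⟨c, hc, e⟩
  · exact h1
  · exfalso
    have h2 : ⟪-α, ρ⟫ = ∑ i, c i * ⟪σ i, ρ⟫ := by
      rw [e, sum_inner]; simp [real_inner_smul_left]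
    rw [inner_neg_left] at h2
    have h3 : ∀ i ∈ Finset.univ, 0 ≤ c i * ⟪σ i, ρ⟫ :=
      fun i _ => mul_nonneg (hc i) (hρ i).le
    have h4 : ∑ i, c i * ⟪σ i, ρ⟫ = 0 := le_antisymm (by linarith) (Finset.sum_nonneg h3)
    rw [Finset.sum_eq_zero_iff_of_nonneg h3] at h4
    have : -α = 0 := by
      rw [e]
      refine Finset.sum_eq_zero fun i hi => ?_
      have := (mul_eq_zero.1 (h4 i hi)).resolve_right (hρ i).ne'
      rw [this, zero_smul]
    exact hΦ.2.1 α hα (neg_eq_zero.1 this)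

theorem inner_ne (hΦ : IsRootSystemFor W Φ)
    {ℓ : ℕ} {σ : Fin ℓ → V} (hσ : IsSimpleSystem Φ σ)
    {ρ : V} (hρ : ∀ i, 0 < ⟪σ i, ρ⟫)
    {α : V} (hα : α ∈ Φ) : ⟪α, ρ⟫ ≠ 0 := by
  intro h
  obtain ⟨c, hc, e⟩ := pos_coef W hΦ hσ hρ hα h.ge
  have h2 : ⟪α, ρ⟫ = ∑ i, c i * ⟪σ i, ρ⟫ := by
    rw [e, sum_inner]; simp [real_inner_smul_left]
  rw [h] at h2
  have h3 : ∀ i ∈ Finset.univ, 0 ≤ c i * ⟪σ i, ρ⟫ :=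
    fun i _ => mul_nonneg (hc i) (hρ i).le
  have h4 := h2.symm
  rw [Finset.sum_eq_zero_iff_of_nonneg h3] at h4
  apply hΦ.2.1 α hα
  rw [e]
  refine Finset.sum_eq_zero fun i hi => ?_
  have := (mul_eq_zero.1 (h4 i hi)).resolve_right (hρ i).ne'
  rw [this, zero_smul]

theorem simple_flip (hΦ : IsRootSystemFor W Φ)
    {ℓ : ℕ} {σ : Fin ℓ → V} (hσ : IsSimpleSystem Φ σ) {s : Fin ℓ → W}
    (hs : ∀ i, reflFormula (σ i) (s i).1) {ρ : V} (hρ : ∀ i, 0 < ⟪σ i, ρ⟫)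
    {α : V} (hα : α ∈ Φ) (h : 0 < ⟪α, ρ⟫) (j : Fin ℓ)
    (h' : ⟪(s j).1 α, ρ⟫ < 0) : α = σ j := by
  obtain ⟨c, hc, e⟩ := pos_coef W hΦ hσ hρ hα h.le
  have hα' : (s j).1 α ∈ Φ := hΦ.2.2.2.2.2.2 _ (s j).2 α hα
  obtain ⟨d, hd, e'⟩ := pos_coef W hΦ hσ hρ (hΦ.2.2.1 _ hα')
    (by rw [inner_neg_left]; linarith)
  have hf := hs j α
  set k : ℝ := 2 * ⟪σ j, α⟫ / ⟪σ j, σ j⟫ with hk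
  have hsum : ∑ i, (c i + d i - (if i = j then k else 0)) • σ i = 0 := by
    simp only [sub_smul, add_smul, Finset.sum_sub_distrib, Finset.sum_add_distrib, ← e, ← e',
      ite_smul, zero_smul, Finset.sum_ite_eq', Finset.sum_ite_eq, Finset.mem_univ, if_true]
    rw [hf]; module
  have hz := Fintype.linearIndependent_iff.1 hσ.2.1 _ hsum
  have hci : ∀ i, i ≠ j → c i = 0 := by
    intro i hi
    have := hz i
    simp only [hi, if_false] at this
    linarith [hc i, hd i]
  have hα2 : α = c j • σ j := by
    rw [e]
    exact Finset.sum_eq_single j (fun i _ hi => by rw [hci i hi, zero_smul]) (by simp)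
  rcases hΦ.2.2.2.1 (σ j) (hσ.1 j) (c j) (hα2 ▸ hα) with h1 | h1
  · rw [hα2, h1, one_smul]
  · linarith [hc j]

theorem exchange (hΦ : IsRootSystemFor W Φ)
    {ℓ : ℕ} {σ : Fin ℓ → V} (hσ : IsSimpleSystem Φ σ) {s : Fin ℓ → W}
    (hs : ∀ i, reflFormula (σ i) (s i).1) {ρ : V} (hρ : ∀ i, 0 < ⟪σ i, ρ⟫)
    (L : List (Fin ℓ)) {α : V} (hα : α ∈ Φ) (h : 0 < ⟪α, ρ⟫)
    (h' : ⟪((L.map s).prod : W).1 α, ρ⟫ < 0) :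
    ∃ a i b, L = a ++ i :: b ∧ ((b.map s).prod : W).1 α = σ i := by
  induction L with
  | nil =>
    simp at h'
    linarith
  | cons j L ih =>
    have hα' : ((L.map s).prod : W).1 α ∈ Φ := hΦ.2.2.2.2.2.2 _ (L.map s).prod.2 α hα
    rcases lt_or_gt_of_ne (inner_ne W hΦ hσ hρ hα') with h1 | h1
    · obtain ⟨a, i, b, e, h2⟩ := ih h1
      exact ⟨j :: a, i, b, by simp [e], h2⟩
    · refine ⟨[], j, L, rfl, simple_flip W hΦ hσ hs hρ hα' h1 j ?_⟩
      simpa using h'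

theorem prod_ne_one {ℓ : ℕ} {σ : Fin ℓ → V} (hσ : IsSimpleSystem Φ σ) {s : Fin ℓ → W}
    (hs : ∀ i, reflFormula (σ i) (s i).1)
    (j : Fin ℓ) (L : List (Fin ℓ)) (hL : (j :: L).Nodup) :
    ((j :: L).map s).prod ≠ 1 := by
  intro h
  have hspan : ∀ (M : List (Fin ℓ)) (v : V), ((M.map s).prod : W).1 v - v ∈
      Submodule.span ℝ (σ '' {i | i ∈ M}) := by
    intro M v
    induction M with
    | nil => simp
    | cons i M ih =>
      have e : (((i :: M).map s).prod : W).1 v = (s i).1 (((M.map s).prod : W).1 v) := by simp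
      rw [e, hs i]
      have h1 : Submodule.span ℝ (σ '' {k | k ∈ M}) ≤ Submodule.span ℝ (σ '' {k | k ∈ i :: M}) :=
        Submodule.span_mono (Set.image_mono (fun k hk => by simp at hk ⊢; exact Or.inr hk))
      have h2 : σ i ∈ Submodule.span ℝ (σ '' {k | k ∈ i :: M}) :=
        Submodule.subset_span ⟨i, by simp, rfl⟩
      have := Submodule.sub_mem _ (h1 ih) (Submodule.smul_mem _
        (2 * ⟪σ i, ((M.map s).prod : W).1 v⟫ / ⟪σ i, σ i⟫) h2)
      convert this using 1
      abel
  have hsj : IsReflection (s j).1 := ⟨σ j, hσ.2.1.ne_zero j, hs j⟩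
  have e1 : (L.map s).prod = s j := by
    have h2 : s j * s j = 1 := Subtype.ext (refl_sq hsj)
    rw [List.map_cons, List.prod_cons] at h
    exact mul_left_cancel (h.trans h2.symm)
  have h3 := hspan L (σ j)
  rw [e1, hs j] at h3
  have h4 : ⟪σ j, σ j⟫ ≠ 0 := inner_self_ne_zero.2 (hσ.2.1.ne_zero j)
  have h5 : σ j - (2 * ⟪σ j, σ j⟫ / ⟪σ j, σ j⟫) • σ j - σ j = (-2 : ℝ) • σ j := by
    rw [mul_div_assoc, div_self h4]; module
  rw [h5] at h3
  have h6 := (Submodule.smul_mem_iff _ (by norm_num : (-2 : ℝ) ≠ 0)).1 h3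
  exact hσ.2.1.notMem_span_image (s := {i | i ∈ L}) (by simpa using (List.nodup_cons.1 hL).1) h6

/-- Change of height under a reflection. -/
theorem height_formula {ρ : V} {α : V} {t : W} (ht : reflFormula α t.1) (x : W) :
    ⟪(x * t).1 ρ, ρ⟫ = ⟪x.1 ρ, ρ⟫ - (2 * ⟪α, ρ⟫ / ⟪α, α⟫) * ⟪x.1 α, ρ⟫ := by
  have e : (x * t).1 ρ = x.1 (t.1 ρ) := rfl
  rw [e, ht ρ, map_sub, map_smul, inner_sub_left, real_inner_smul_left]

theorem mono_equiv (hΦ : IsRootSystemFor W Φ)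
    {ℓ : ℕ} {σ : Fin ℓ → V} (hσ : IsSimpleSystem Φ σ) {s : Fin ℓ → W}
    (hs : ∀ i, reflFormula (σ i) (s i).1) {ρ : V} (hρ : ∀ i, 0 < ⟪σ i, ρ⟫)
    (T : List W) : ∀ L : List (Fin ℓ), L.Nodup → (∀ t ∈ T, IsReflection t.1) →
    T.prod = (L.map s).prod →
    (∀ a t b, T = a ++ t :: b → ⟪(a.prod * t).1 ρ, ρ⟫ < ⟪a.prod.1 ρ, ρ⟫) →
    R T (L.map s) := by
  have hsq : ∀ i, s i * s i = 1 := fun i =>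
    Subtype.ext (refl_sq ⟨σ i, hσ.2.1.ne_zero i, hs i⟩)
  induction T using List.reverseRecOn with
  | nil =>
    intro L hL _ hp _
    cases L with
    | nil => exact Relation.ReflTransGen.refl
    | cons j L => exact absurd hp.symm (prod_ne_one W hσ hs j L hL)
  | append_singleton T t ih =>
    intro L hL hT hp hm
    have htr : IsReflection t.1 := hT t (by simp)
    have htt : t * t = 1 := Subtype.ext (refl_sq htr)
    have hlast := hm T t [] rfl
    have hp' : T.prod * t = (L.map s).prod := by simpa using hp
    obtain ⟨α, hα, hpos, hf⟩ : ∃ α ∈ Φ, 0 < ⟪α, ρ⟫ ∧ reflFormula α t.1 := by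
      obtain ⟨α, hα, hf⟩ := hΦ.2.2.2.2.2.1 t.1 t.2 htr
      rcases lt_or_gt_of_ne (inner_ne W hΦ hσ hρ hα) with h | h
      · refine ⟨-α, hΦ.2.2.1 α hα, by rw [inner_neg_left]; linarith, fun v => ?_⟩
        rw [hf v, inner_neg_left, inner_neg_neg, smul_neg, ← neg_smul]
        congr 2
        ring
      · exact ⟨α, hα, h, hf⟩
    have hTp : T.prod = (L.map s).prod * t := by rw [← hp', mul_assoc, htt, mul_one]
    have hneg : ⟪((L.map s).prod : W).1 α, ρ⟫ < 0 := by
      have h1 := height_formula W (ρ := ρ) hf (L.map s).prod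
      rw [← hTp] at h1
      rw [hp'] at hlast
      have h2 : 0 < ⟪α, α⟫ := real_inner_self_pos.2 (hΦ.2.1 α hα)
      have h3 : 0 < 2 * ⟪α, ρ⟫ / ⟪α, α⟫ := by positivity
      by_contra hcon
      have := mul_nonneg h3.le (not_lt.1 hcon)
      linarith
    obtain ⟨a, i, b, rfl, hb⟩ := exchange W hΦ hσ hs hρ L hα hpos hneg
    have hconj : (b.map s).prod * t * (b.map s).prod⁻¹ = s i := by
      apply Subtype.ext
      have := refl_conj_formula (g := ((b.map s).prod : W).1) hf
      rw [hb] at this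
      exact formula_unique this (hs i)
    have ht : t = (b.map s).prod⁻¹ * s i * (b.map s).prod := by
      rw [← hconj]; group
    have h1 : R T ((a ++ b).map s) := by
      refine ih (a ++ b) ?_ (fun t ht => hT t (by simp [ht])) ?_ ?_
      · exact hL.sublist (by simp)
      · rw [hTp]
        simp only [List.map_append, List.map_cons, List.prod_append, List.prod_cons]
        rw [← hconj]
        have : t * t = 1 := htt
        calc _ = (a.map s).prod * (b.map s).prod * (t * t) := by group
          _ = _ := by simp [htt]
      · intro x y z e
        exact hm x y (z ++ [t]) (by simp [e])
    have h2 := R.app [] [t] h1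
    have h3 := R.app (a.map s) [] (R.shift (b.map s) (by
      intro x hx
      obtain ⟨k, _, rfl⟩ := List.mem_map.1 hx
      exact hsq k) (s i))
    rw [← ht] at h3
    refine R.trans h2 ?_
    simpa using h3.symm

theorem all_equiv (hΦ : IsRootSystemFor W Φ)
    {ℓ : ℕ} {σ : Fin ℓ → V} (hσ : IsSimpleSystem Φ σ) {s : Fin ℓ → W}
    (hs : ∀ i, reflFormula (σ i) (s i).1) {ρ : V} (hρ : ∀ i, 0 < ⟪σ i, ρ⟫)
    [Finite W] (L : List (Fin ℓ)) (hL : L.Nodup) (l : List W)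
    (hl : ∀ t ∈ l, IsReflection t.1) (hlen : l.length = refLen W (L.map s).prod)
    (hp : l.prod = (L.map s).prod) : R l (L.map s) := by
  have hsq : ∀ t : W, IsReflection t.1 → t * t = 1 := fun t ht => Subtype.ext (refl_sq ht)
  have hcj : ∀ s t : W, IsReflection s.1 → IsReflection t.1 → IsReflection (s * t * s).1 :=
    fun s t h1 h2 => refl_conj h1 h2
  have hne : ∀ (x t : W), IsReflection t.1 → ⟪(x * t).1 ρ, ρ⟫ ≠ ⟪x.1 ρ, ρ⟫ := by
    intro x t ht
    obtain ⟨α, hα, hf⟩ := hΦ.2.2.2.2.2.1 t.1 t.2 ht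
    rw [height_formula W (ρ := ρ) hf x]
    have h1 := inner_ne W hΦ hσ hρ hα
    have h2 := inner_ne W hΦ hσ hρ (hΦ.2.2.2.2.2.2 x.1 x.2 α hα)
    have h3 : ⟪α, α⟫ ≠ 0 := inner_self_ne_zero.2 (hΦ.2.1 α hα)
    intro h
    have : (2 * ⟪α, ρ⟫ / ⟪α, α⟫) * ⟪x.1 α, ρ⟫ ≠ 0 := by positivity
    apply this
    linarith
  have key := exists_mono (fun g : W => ⟪g.1 ρ, ρ⟫) (fun t : W => IsReflection t.1)
    hsq hcj ?_ hne ?_ l hl ?_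
  · obtain ⟨l', h1, h2⟩ := key
    obtain ⟨i1, _, i3⟩ := R.inv h1 (fun t : W => IsReflection t.1) hsq hcj hl
    exact R.trans h1
      (mono_equiv W hΦ hσ hs hρ l' L hL i1 (i3.trans hp) h2)
  · intro t ht
    obtain ⟨α, hα, hf⟩ := hΦ.2.2.2.2.2.1 t.1 t.2 ht
    have h1 := height_formula W (ρ := ρ) hf 1
    have h2 : 0 < ⟪α, α⟫ := real_inner_self_pos.2 (hΦ.2.1 α hα)
    have h3 := inner_ne W hΦ hσ hρ hα
    have h4 : (1 : W).1 α = α := rfl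
    rw [h4, one_mul] at h1
    have h5 : 0 < 2 * ⟪α, ρ⟫ / ⟪α, α⟫ * ⟪α, ρ⟫ := by
      have : 2 * ⟪α, ρ⟫ / ⟪α, α⟫ * ⟪α, ρ⟫ = 2 * ⟪α, ρ⟫ ^ 2 / ⟪α, α⟫ := by ring
      rw [this]; positivity
    linarith
  · intro u x y hx hy hxy
    have hu : ∀ g : V, ⟪u.1 g, ρ⟫ = ⟪g, (u⁻¹).1 ρ⟫ := by
      intro g
      have hv : u.1 ((u⁻¹).1 ρ) = ρ := by
        change (u * u⁻¹).1 ρ = ρ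
        simp
      conv_lhs => rw [← hv]
      exact u.1.inner_map_map _ _
    intro h1 h2
    have k1 : ⟪ρ, (u⁻¹).1 ρ⟫ < ⟪x.1 ρ, (u⁻¹).1 ρ⟫ := by
      rw [← hu, ← hu]; exact h1
    have k2 : ⟪ρ, (u⁻¹).1 ρ⟫ < ⟪y.1 ρ, (u⁻¹).1 ρ⟫ := by
      rw [← hu, ← hu]; exact h2
    have := peak_real hx hy (fun h => hxy (Subtype.ext h)) k1 k2
    rw [← hu, ← hu, ← hu] at this
    exact this
  · intro l' h1 h2
    rw [hlen]
    exact Nat.sInf_le ⟨l', rfl, h1, h2.trans hp⟩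

end main

theorem exists_rho {V : Type*} [NormedAddCommGroup V] [InnerProductSpace ℝ V]
    [FiniteDimensional ℝ V] {ℓ : ℕ} {σ : Fin ℓ → V} (h : LinearIndependent ℝ σ) :
    ∃ ρ : V, ∀ i, 0 < ⟪σ i, ρ⟫ := by
  let φ : V →ₗ[ℝ] ℝ := (Module.Basis.extend h.linearIndepOn_id).constr ℝ (fun _ => (1 : ℝ))
  refine ⟨(InnerProductSpace.toDual ℝ V).symm (LinearMap.toContinuousLinearMap φ), fun i => ?_⟩
  rw [real_inner_comm, InnerProductSpace.toDual_symm_apply]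
  have hi : σ i ∈ h.linearIndepOn_id.extend (Set.subset_univ _) :=
    h.linearIndepOn_id.subset_extend _ ⟨i, rfl⟩
  have : φ (σ i) = 1 := by
    have h1 := (Module.Basis.extend h.linearIndepOn_id).constr_basis ℝ (fun _ => (1 : ℝ)) ⟨σ i, hi⟩
    rwa [Module.Basis.extend_apply_self] at h1
  simp [this]

end Hur

/-- The braid group acts transitively by Hurwitz moves on the set of shortest
factorizations of a Coxeter element `γ` into reflections: any two such factorizations
are connected by a sequence of Hurwitz moves and their inverses. -/
theorem statement16 {V : Type*} [NormedAddCommGroup V] [InnerProductSpace ℝ V]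
    [FiniteDimensional ℝ V]
    (W : Subgroup (V ≃ₗᵢ[ℝ] V)) (hW : IsReflectionGroup W)
    (Φ : Set V) (hΦ : IsRootSystemFor W Φ)
    (γ : W) (hγ : IsCoxeterElement W Φ (Module.finrank ℝ V) γ)
    (l₁ l₂ : List W)
    (h₁ : (∀ t ∈ l₁, IsReflection (t : W).1) ∧ l₁.length = refLen W γ ∧ l₁.prod = γ)
    (h₂ : (∀ t ∈ l₂, IsReflection (t : W).1) ∧ l₂.length = refLen W γ ∧ l₂.prod = γ) :
    Relation.ReflTransGen (fun x y => HurwitzStep x y ∨ HurwitzStep y x) l₁ l₂ := by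
  obtain ⟨σ, hσ, s, hs, L, hL, _, rfl⟩ := hγ
  obtain ⟨ρ, hρ⟩ := Hur.exists_rho hσ.2.1
  have := hW.1
  have e₁ := Hur.all_equiv W hΦ hσ hs hρ L hL l₁ h₁.1 h₁.2.1 h₁.2.2
  have e₂ := Hur.all_equiv W hΦ hσ hs hρ L hL l₂ h₂.1 h₂.2.1 h₂.2.2
  exact Hur.R.trans e₁ e₂.symm
end
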